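/- arXiv:2201.08426 — 2 statements merged into one kernel-verified Lean document; each statement's English description precedes it below -/
import Mathlib

section
/- Remainder bound via comparison: Let d ≥ 1, T > 0, and let u, w : [0,T] × ℝ^d → ℝ be bounded continuous functions, C^1 in time and C^2 in space on (0,T) × ℝ^d, with the same initial data u(0,·) = w(0,·), such that ∂_t u = Δu + u - u^3 and ∂_t w = Δw + w - w^3 + R on (0,T) × ℝ^d, where R is bounded and measurable. Then for all (t,x) ∈ [0,T] × ℝ^d one has |u(t,x) - w(t,x)| ≤ ∫_0^t e^{t-s} ∫_{ℝ^d} p_{t-s}(x-y) |R(s,y)| dy ds. -/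
open Real Filter MeasureTheory

/-- The heat kernel `p_t(x) = (4πt)^{-d/2} exp(-|x|²/(4t))` on `ℝ^d`. -/
noncomputable def heatKernel (d : ℕ) (t : ℝ) (x : EuclideanSpace ℝ (Fin d)) : ℝ :=
  (4 * Real.pi * t) ^ (-(d : ℝ) / 2) * Real.exp (-‖x‖ ^ 2 / (4 * t))

/-- The Laplacian of `f : ℝ^d → ℝ`: the sum of the second partial derivatives in the
`d` coordinate directions. -/
noncomputable def laplacian {d : ℕ} (f : EuclideanSpace ℝ (Fin d) → ℝ)
    (x : EuclideanSpace ℝ (Fin d)) : ℝ :=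
  ∑ i : Fin d,
    fderiv ℝ (fun y => fderiv ℝ f y (EuclideanSpace.single i 1)) x (EuclideanSpace.single i 1)

section HeatSemigroup

open ProbabilityTheory Topology

variable {d : ℕ}

/-- The heat semigroup `(e^{rΔ} φ)(x)`, written as a Gaussian average of `φ` around `x`. -/
noncomputable def heatSemigroup (r : ℝ) (φ : EuclideanSpace ℝ (Fin d) → ℝ)
    (x : EuclideanSpace ℝ (Fin d)) : ℝ :=
  ∫ z, φ (x + √(2 * r) • z) ∂(stdGaussian (EuclideanSpace ℝ (Fin d)))

lemma heatKernel_nonneg {r : ℝ} (hr : 0 ≤ r) (x : EuclideanSpace ℝ (Fin d)) :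
    0 ≤ heatKernel d r x := by
  unfold heatKernel
  positivity

lemma continuous_heatKernel (r : ℝ) : Continuous (heatKernel d r) := by
  unfold heatKernel
  fun_prop

lemma integrable_exp_neg_mul_sq_norm {b : ℝ} (hb : 0 < b) :
    Integrable (fun x : EuclideanSpace ℝ (Fin d) => rexp (-b * ‖x‖ ^ 2)) := by
  have h := (GaussianFourier.integrable_cexp_neg_mul_sq_norm_add
    (V := EuclideanSpace ℝ (Fin d)) (b := (b : ℂ)) (by simpa using hb) 0 0).re
  refine h.congr (Eventually.of_forall fun x => ?_)
  have : (-(b : ℂ) * (‖x‖ : ℂ) ^ 2 + 0 * ((inner ℝ (0 : EuclideanSpace ℝ (Fin d)) x : ℝ) : ℂ))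
      = ((-b * ‖x‖ ^ 2 : ℝ) : ℂ) := by push_cast; ring
  simp only [this]
  exact Complex.exp_ofReal_re _

lemma integrable_heatKernel {r : ℝ} (hr : 0 < r) : Integrable (heatKernel d r) := by
  unfold heatKernel
  refine Integrable.const_mul ?_ _
  have := integrable_exp_neg_mul_sq_norm (d := d) (b := (4 * r)⁻¹) (by positivity)
  refine this.congr (Eventually.of_forall fun x => ?_)
  simp only
  congr 1
  field_simp

/-- The law of `√(2r) Z`, with `Z` standard Gaussian, has the heat kernel as its density. -/
lemma map_smul_stdGaussian {r : ℝ} (hr : 0 < r) :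
    (stdGaussian (EuclideanSpace ℝ (Fin d))).map (√(2 * r) • ·) =
      volume.withDensity (fun x => ENNReal.ofReal (heatKernel d r x)) := by
  have : IsFiniteMeasure (volume.withDensity (fun x => ENNReal.ofReal (heatKernel d r x))) :=
    isFiniteMeasure_withDensity_ofReal (integrable_heatKernel hr).2
  refine Measure.ext_of_charFun (funext fun t => ?_)
  rw [charFun_map_smul, charFun_stdGaussian, charFun_apply,
    integral_withDensity_eq_integral_toReal_smul
      (continuous_heatKernel r).measurable.ennreal_ofReal (by simp)]
  have key := GaussianFourier.integral_cexp_neg_mul_sq_norm_add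
    (V := EuclideanSpace ℝ (Fin d)) (b := (((4 * r)⁻¹ : ℝ) : ℂ))
    (by rw [Complex.ofReal_re]; positivity) Complex.I t
  have h' : ∀ x : EuclideanSpace ℝ (Fin d), (ENNReal.ofReal (heatKernel d r x)).toReal •
      Complex.exp (((inner ℝ x t : ℝ) : ℂ) * Complex.I) =
      (((4 * π * r) ^ (-(d : ℝ) / 2) : ℝ) : ℂ) *
        Complex.exp (-(((4 * r)⁻¹ : ℝ) : ℂ) * (‖x‖ : ℂ) ^ 2 +
          Complex.I * ((inner ℝ t x : ℝ) : ℂ)) := by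
    intro x
    rw [ENNReal.toReal_ofReal (heatKernel_nonneg hr.le x), Complex.real_smul, heatKernel,
      Complex.exp_add, real_inner_comm t x]
    push_cast
    rw [mul_assoc]
    congr 2
    · congr 1
      field_simp
    · ring_nf
  simp_rw [h']
  rw [integral_const_mul, key, ← mul_assoc, finrank_euclideanSpace_fin]
  have h1 : (((4 * π * r) ^ (-(d : ℝ) / 2) : ℝ) : ℂ) *
      ((π : ℂ) / (((4 * r)⁻¹ : ℝ) : ℂ)) ^ ((d : ℂ) / 2) = 1 := by
    rw [← Complex.ofReal_div, show ((d : ℂ) / 2) = (((d : ℝ) / 2 : ℝ) : ℂ) by push_cast; rfl,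
      ← Complex.ofReal_cpow (by positivity), ← Complex.ofReal_mul, div_inv_eq_mul,
      show π * (4 * r) = 4 * π * r by ring, ← rpow_add (by positivity)]
    ring_nf
    simp
  rw [h1, one_mul]
  congr 1
  rw [norm_smul, norm_of_nonneg (sqrt_nonneg _), Complex.I_sq]
  have : ((√(2 * r) : ℝ) : ℂ) ^ 2 = 2 * r := by
    rw [← Complex.ofReal_pow, sq_sqrt (by positivity)]; push_cast; rfl
  push_cast
  rw [mul_pow, this]
  have : (r : ℂ) ≠ 0 := by exact_mod_cast hr.ne'
  field_simp

lemma heatSemigroup_eq_integral_heatKernel {r : ℝ} (hr : 0 < r)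
    {φ : EuclideanSpace ℝ (Fin d) → ℝ} (hφ : Measurable φ) (x : EuclideanSpace ℝ (Fin d)) :
    heatSemigroup r φ x = ∫ y, heatKernel d r (x - y) * φ y := by
  have hm : Measurable fun z => φ (x + z) := hφ.comp (measurable_const_add x)
  have h1 : heatSemigroup r φ x =
      ∫ z, φ (x + z) ∂((stdGaussian (EuclideanSpace ℝ (Fin d))).map (√(2 * r) • ·)) := by
    rw [integral_map (by fun_prop) hm.aestronglyMeasurable]
    rfl
  rw [h1, map_smul_stdGaussian hr, integral_withDensity_eq_integral_toReal_smul
      (continuous_heatKernel r).measurable.ennreal_ofReal (by simp),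
    ← integral_add_left_eq_self (fun y => heatKernel d r (x - y) * φ y) x]
  refine integral_congr_ae (Eventually.of_forall fun y => ?_)
  simp only [ENNReal.toReal_ofReal (heatKernel_nonneg hr.le _), smul_eq_mul]
  simp [heatKernel]

@[simp]
lemma heatSemigroup_zero (φ : EuclideanSpace ℝ (Fin d) → ℝ) : heatSemigroup 0 φ = φ := by
  ext x
  simp [heatSemigroup]

lemma integrable_comp_add_smul {φ : EuclideanSpace ℝ (Fin d) → ℝ} (hφ : Continuous φ) {M : ℝ}
    (hM : ∀ x, |φ x| ≤ M) (x : EuclideanSpace ℝ (Fin d)) (c : ℝ) :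
    Integrable (fun z => φ (x + c • z)) (stdGaussian (EuclideanSpace ℝ (Fin d))) :=
  Integrable.of_bound (by fun_prop) M (Eventually.of_forall fun z => hM _)

lemma abs_heatSemigroup_le_abs (r : ℝ) (φ : EuclideanSpace ℝ (Fin d) → ℝ)
    (x : EuclideanSpace ℝ (Fin d)) :
    |heatSemigroup r φ x| ≤ heatSemigroup r (fun y => |φ y|) x :=
  abs_integral_le_integral_abs

lemma abs_heatSemigroup_le {r : ℝ} {φ : EuclideanSpace ℝ (Fin d) → ℝ} {M : ℝ}
    (hM : ∀ x, |φ x| ≤ M) (x : EuclideanSpace ℝ (Fin d)) : |heatSemigroup r φ x| ≤ M := by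
  have := norm_integral_le_of_norm_le_const (μ := stdGaussian (EuclideanSpace ℝ (Fin d)))
    (f := fun z => φ (x + √(2 * r) • z)) (C := M) (Eventually.of_forall fun z => hM _)
  rw [probReal_univ, mul_one] at this
  exact this

lemma continuous_heatSemigroup {φ : EuclideanSpace ℝ (Fin d) → ℝ} (hφ : Continuous φ) {M : ℝ}
    (hM : ∀ x, |φ x| ≤ M) :
    Continuous (fun p : ℝ × EuclideanSpace ℝ (Fin d) => heatSemigroup p.1 φ p.2) := by
  unfold heatSemigroup
  refine continuous_of_dominated (bound := fun _ => M) (fun p => by fun_prop)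
    (fun p => Eventually.of_forall fun z => hM _) (integrable_const _)
    (Eventually.of_forall fun z => by fun_prop)

lemma heatSemigroup_heatSemigroup {a b : ℝ} (ha : 0 ≤ a) (hb : 0 ≤ b)
    {φ : EuclideanSpace ℝ (Fin d) → ℝ} (hφ : Continuous φ) {M : ℝ} (hM : ∀ x, |φ x| ≤ M) :
    heatSemigroup a (heatSemigroup b φ) = heatSemigroup (a + b) φ := by
  ext x
  rcases (add_nonneg ha hb).eq_or_lt with h0 | h0
  · obtain rfl : a = 0 := by linarith
    simp
  set γ := stdGaussian (EuclideanSpace ℝ (Fin d))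
  have hz : ‖(⟨√(2 * a), √(2 * b)⟩ : ℂ)‖ = √(2 * (a + b)) := by
    rw [Complex.norm_eq_sqrt_sq_add_sq]
    simp only
    rw [sq_sqrt (by positivity), sq_sqrt (by positivity)]
    ring_nf
  obtain ⟨θ, hc, hs⟩ : ∃ θ : ℝ, √(2 * (a + b)) * cos θ = √(2 * a) ∧
      √(2 * (a + b)) * sin θ = √(2 * b) := by
    refine ⟨Complex.arg ⟨√(2 * a), √(2 * b)⟩, ?_, ?_⟩
    · rw [← hz, Complex.norm_mul_cos_arg]
    · rw [← hz, Complex.norm_mul_sin_arg]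
  have hrot := IsGaussian.map_rotation_eq_self (μ := γ) integral_id_stdGaussian θ
  have hint : Integrable (fun p : EuclideanSpace ℝ (Fin d) × EuclideanSpace ℝ (Fin d) =>
      φ (x + √(2 * a) • p.1 + √(2 * b) • p.2)) (γ.prod γ) :=
    Integrable.of_bound (by fun_prop) M (Eventually.of_forall fun z => hM _)
  have e1 : heatSemigroup a (heatSemigroup b φ) x =
      ∫ p, φ (x + √(2 * a) • p.1 + √(2 * b) • p.2) ∂(γ.prod γ) := by
    rw [integral_prod _ hint]
    rfl
  have e2 : heatSemigroup (a + b) φ x =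
      ∫ p, φ (x + √(2 * (a + b)) • p.1) ∂(γ.prod γ) := by
    rw [integral_fun_fst (μ := γ) (ν := γ) (fun z => φ (x + √(2 * (a + b)) • z))]
    simp [heatSemigroup, γ]
  rw [e1, e2]
  conv_rhs => rw [← hrot, integral_map (by fun_prop) (by fun_prop)]
  refine integral_congr_ae (Eventually.of_forall fun p => ?_)
  simp only [ContinuousLinearMap.rotation_apply, smul_add, smul_smul, hc, hs, add_assoc]

/-- Second-order Taylor expansion at a point of twice continuous differentiability. -/
lemma ContDiffAt.isLittleO_taylor_two {E : Type*} [NormedAddCommGroup E] [NormedSpace ℝ E]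
    {φ : E → ℝ} {x : E} (hφ : ContDiffAt ℝ 2 φ x) :
    (fun k => φ (x + k) - φ x - fderiv ℝ φ x k - 2⁻¹ * fderiv ℝ (fderiv ℝ φ) x k k)
      =o[𝓝 0] fun k => ‖k‖ ^ 2 := by
  set B := fderiv ℝ (fderiv ℝ φ) x
  have hB : HasFDerivAt (fderiv ℝ φ) B x :=
    ((hφ.fderiv_right (m := 1) (by norm_num)).differentiableAt (by norm_num)).hasFDerivAt
  have hsymm : ∀ a b, B a b = B b a := fun a b =>
    (hφ.isSymmSndFDerivAt (by simp)) a b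
  have hadd : Tendsto (fun k : E => x + k) (𝓝 0) (𝓝 x) := by
    simpa using (continuous_const_add x).tendsto 0
  have hdiff : ∀ᶠ k in 𝓝 (0 : E), DifferentiableAt ℝ φ (x + k) :=
    hadd.eventually ((hφ.eventually (by simp)).mono fun y hy => hy.differentiableAt (by norm_num))
  refine Asymptotics.isLittleO_iff.2 fun c hc => ?_
  have h1 := (hasFDerivAt_iff_isLittleO_nhds_zero.1 hB).def hc
  obtain ⟨δ, hδ, hball⟩ := Metric.eventually_nhds_iff_ball.1 (hdiff.and h1)
  filter_upwards [Metric.ball_mem_nhds 0 hδ] with k hk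
  have hsub : ∀ j ∈ Metric.closedBall (0 : E) ‖k‖, j ∈ Metric.ball (0 : E) δ := fun j hj => by
    simp only [Metric.mem_ball, Metric.mem_closedBall, dist_zero_right] at *
    linarith
  have hderiv : ∀ j ∈ Metric.closedBall (0 : E) ‖k‖, HasFDerivWithinAt
      (fun k => φ (x + k) - φ x - fderiv ℝ φ x k - 2⁻¹ * B k k)
      (fderiv ℝ φ (x + j) - fderiv ℝ φ x - B j) (Metric.closedBall 0 ‖k‖) j := by
    intro j hj
    have d1 : HasFDerivAt (fun k => φ (x + k)) (fderiv ℝ φ (x + j)) j := by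
      have := (hball j (hsub j hj)).1.hasFDerivAt.comp j ((hasFDerivAt_id j).const_add x)
      simpa [Function.comp_def] using this
    have d2 : HasFDerivAt (fun k => B k k) _ j := B.hasFDerivAt.clm_apply (hasFDerivAt_id j)
    refine (((d1.sub_const (φ x)).sub (fderiv ℝ φ x).hasFDerivAt).sub
      (d2.const_mul 2⁻¹)).hasFDerivWithinAt.congr_fderiv ?_
    ext e
    simp [hsymm e j]
    ring
  have hbound : ∀ j ∈ Metric.closedBall (0 : E) ‖k‖,
      ‖fderiv ℝ φ (x + j) - fderiv ℝ φ x - B j‖ ≤ c * ‖k‖ := fun j hj =>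
    ((hball j (hsub j hj)).2).trans
      (mul_le_mul_of_nonneg_left (by simpa using hj) hc.le)
  have := (convex_closedBall (0 : E) ‖k‖).norm_image_sub_le_of_norm_hasFDerivWithin_le
    hderiv hbound (x := 0) (y := k) (by simp) (by simp)
  simp only [add_zero, sub_self, map_zero, mul_zero, sub_zero] at this
  simpa [mul_assoc, pow_two] using this

lemma memLp_two_id_stdGaussian :
    MemLp id 2 (stdGaussian (EuclideanSpace ℝ (Fin d))) := IsGaussian.memLp_two_id

lemma integrable_norm_sq_stdGaussian :
    Integrable (fun z => ‖z‖ ^ 2) (stdGaussian (EuclideanSpace ℝ (Fin d))) :=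
  memLp_two_id_stdGaussian.integrable_norm_pow (by norm_num)

lemma integral_bilin_stdGaussian
    (B : EuclideanSpace ℝ (Fin d) →L[ℝ] EuclideanSpace ℝ (Fin d) →L[ℝ] ℝ) :
    ∫ z, B z z ∂(stdGaussian (EuclideanSpace ℝ (Fin d))) =
      ∑ i, B (EuclideanSpace.single i 1) (EuclideanSpace.single i 1) := by
  set γ := stdGaussian (EuclideanSpace ℝ (Fin d))
  have hcoord : ∀ i, MemLp (fun z : EuclideanSpace ℝ (Fin d) => z i) 2 γ := fun i =>
    (memLp_two_id_stdGaussian.norm.of_le (f := fun z => z i) (by fun_prop)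
      (Eventually.of_forall fun z => by simpa using PiLp.norm_apply_le z i))
  have hexp : ∀ z : EuclideanSpace ℝ (Fin d), B z z = ∑ i, ∑ j,
      z i * z j * B (EuclideanSpace.single i 1) (EuclideanSpace.single j 1) := by
    intro z
    have hz : z = ∑ i, z i • EuclideanSpace.single i (1 : ℝ) := by
      simpa using ((EuclideanSpace.basisFun (Fin d) ℝ).sum_repr z).symm
    conv_lhs => rw [hz]
    simp only [map_sum, map_smul, sum_apply, smul_apply, smul_eq_mul, Finset.mul_sum]
    rw [Finset.sum_comm]
    exact Finset.sum_congr rfl fun i _ => Finset.sum_congr rfl fun j _ => by ring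
  have hint : ∀ i j, Integrable (fun z : EuclideanSpace ℝ (Fin d) => z i * z j) γ := fun i j =>
    (hcoord i).integrable_mul (hcoord j)
  have hcov : ∀ i j, ∫ z, z i * z j ∂γ = if i = j then 1 else 0 := by
    intro i j
    have h := covarianceBilin_apply (μ := γ) memLp_two_id_stdGaussian
      (EuclideanSpace.single i (1 : ℝ)) (EuclideanSpace.single j (1 : ℝ))
    rw [covarianceBilin_stdGaussian] at h
    simp [γ, EuclideanSpace.inner_single_left] at h
    rw [← h, innerSL_apply_apply, EuclideanSpace.inner_single_left]
    simp
  simp_rw [hexp]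
  rw [integral_finsetSum _ fun i _ => integrable_finsetSum _ fun j _ => (hint i j).mul_const _]
  refine Finset.sum_congr rfl fun i _ => ?_
  rw [integral_finsetSum _ fun j _ => (hint i j).mul_const _]
  simp [integral_mul_const, hcov]

lemma laplacian_eq_sum_fderiv_fderiv {φ : EuclideanSpace ℝ (Fin d) → ℝ}
    {x : EuclideanSpace ℝ (Fin d)} (hφ : ContDiffAt ℝ 2 φ x) :
    laplacian φ x = ∑ i, fderiv ℝ (fderiv ℝ φ) x (EuclideanSpace.single i 1)
      (EuclideanSpace.single i 1) := by
  refine Finset.sum_congr rfl fun i _ => ?_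
  have hB : DifferentiableAt ℝ (fderiv ℝ φ) x :=
    (hφ.fderiv_right (m := 1) (by norm_num)).differentiableAt (by norm_num)
  rw [(hB.hasFDerivAt.clm_apply (hasFDerivAt_const _ x)).fderiv]
  simp

/-- The Laplacian is the pointwise generator of the heat semigroup. -/
lemma tendsto_heatSemigroup_sub_div {φ : EuclideanSpace ℝ (Fin d) → ℝ} (hφc : Continuous φ) {M : ℝ}
    (hM : ∀ x, |φ x| ≤ M) {x : EuclideanSpace ℝ (Fin d)} (hφ : ContDiffAt ℝ 2 φ x) :
    Tendsto (fun h => (heatSemigroup h φ x - φ x) / h) (𝓝[>] 0) (𝓝 (laplacian φ x)) := by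
  set γ := stdGaussian (EuclideanSpace ℝ (Fin d))
  set L := fderiv ℝ φ x
  set B := fderiv ℝ (fderiv ℝ φ) x
  have ho := hφ.isLittleO_taylor_two
  obtain ⟨C, hC⟩ : ∃ C, ∀ k, |φ (x + k) - φ x - L k| ≤ C * ‖k‖ ^ 2 := by
    obtain ⟨δ, hδ, hball⟩ := Metric.eventually_nhds_iff_ball.1 (ho.def one_pos)
    refine ⟨(1 + 2⁻¹ * ‖B‖) + (2 * M / δ ^ 2 + ‖L‖ / δ), fun k => ?_⟩
    have hM0 : 0 ≤ M := (abs_nonneg _).trans (hM x)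
    have hLk : |L k| ≤ ‖L‖ * ‖k‖ := L.le_opNorm k
    by_cases hk : ‖k‖ < δ
    · have h1 := hball k (by simpa using hk)
      have h2 : |B k k| ≤ ‖B‖ * ‖k‖ * ‖k‖ := B.le_opNorm₂ k k
      simp only [norm_eq_abs, one_mul, abs_pow, abs_norm] at h1
      have h3 : 0 ≤ (2 * M / δ ^ 2 + ‖L‖ / δ) * ‖k‖ ^ 2 := by positivity
      rw [abs_le] at *
      constructor <;> nlinarith
    · have hk' : 1 ≤ ‖k‖ / δ := (one_le_div hδ).2 (not_lt.1 hk)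
      have h1 : 2 * M ≤ 2 * M * (‖k‖ / δ) ^ 2 :=
        le_mul_of_one_le_right (by positivity) (one_le_pow₀ hk')
      have h2 : ‖L‖ * ‖k‖ ≤ ‖L‖ * ‖k‖ * (‖k‖ / δ) := le_mul_of_one_le_right (by positivity) hk'
      have h3 : 0 ≤ (1 + 2⁻¹ * ‖B‖) * ‖k‖ ^ 2 := by positivity
      have e : ((1 + 2⁻¹ * ‖B‖) + (2 * M / δ ^ 2 + ‖L‖ / δ)) * ‖k‖ ^ 2 =
          (1 + 2⁻¹ * ‖B‖) * ‖k‖ ^ 2 + 2 * M * (‖k‖ / δ) ^ 2 + ‖L‖ * ‖k‖ * (‖k‖ / δ) := by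
        field_simp
        ring
      have h4 := hM (x + k)
      have h5 := hM x
      rw [e]
      rw [abs_le] at *
      constructor <;> linarith
  have hLint : ∀ h : ℝ, ∫ z, L (√(2 * h) • z) ∂γ = 0 := fun h => by
    simp [integral_const_mul, γ]
  have hLi : ∀ h : ℝ, Integrable (fun z => L (√(2 * h) • z)) γ := fun h => by
    simpa only [map_smul, smul_eq_mul, id_eq] using
      (L.integrable_comp (IsGaussian.integrable_id (μ := γ))).const_mul √(2 * h)
  have hrepr : ∀ h : ℝ, (heatSemigroup h φ x - φ x) / h =
      ∫ z, (φ (x + √(2 * h) • z) - φ x - L (√(2 * h) • z)) / h ∂γ := by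
    intro h
    rw [integral_div, integral_sub _ (hLi h), integral_sub, hLint, heatSemigroup]
    · simp [γ]
    · exact integrable_comp_add_smul hφc hM x _
    · exact integrable_const _
    · exact (integrable_comp_add_smul hφc hM x _).sub (integrable_const _)
  simp_rw [hrepr]
  rw [laplacian_eq_sum_fderiv_fderiv hφ, ← integral_bilin_stdGaussian B]
  refine tendsto_integral_filter_of_dominated_convergence (fun z => C * 2 * ‖z‖ ^ 2)
    (Eventually.of_forall fun h => by fun_prop) ?_
    (integrable_norm_sq_stdGaussian.const_mul _) (Eventually.of_forall fun z => ?_)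
  · filter_upwards [self_mem_nhdsWithin] with h hh
    have hh : 0 < h := hh
    refine Eventually.of_forall fun z => ?_
    rw [norm_div, norm_eq_abs, norm_of_nonneg hh.le, div_le_iff₀ hh]
    refine (hC _).trans_eq ?_
    rw [norm_smul, norm_of_nonneg (sqrt_nonneg _), mul_pow, sq_sqrt (by positivity)]
    ring
  · have hk : Tendsto (fun h : ℝ => √(2 * h) • z) (𝓝[>] 0) (𝓝 0) := by
      have : Continuous (fun h : ℝ => √(2 * h) • z) := by fun_prop
      simpa using (this.tendsto 0).mono_left nhdsWithin_le_nhds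
    have h1 := ho.comp_tendsto hk
    have h2 : (fun h : ℝ => φ (x + √(2 * h) • z) - φ x - L (√(2 * h) • z) - h * B z z)
        =o[𝓝[>] 0] fun h => h := by
      refine (h1.congr' ?_ (g₂ := fun h => (2 * ‖z‖ ^ 2) * h) ?_).trans_isBigO
        (Asymptotics.isBigO_const_mul_self _ _ _)
      · filter_upwards [self_mem_nhdsWithin] with h hh
        have hh : 0 < h := hh
        have : √(2 * h) * √(2 * h) = 2 * h := mul_self_sqrt (by positivity)
        simp only [Function.comp, map_smul, smul_apply, smul_eq_mul]
        rw [← mul_assoc (√(2 * h)), this]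
        ring
      · filter_upwards [self_mem_nhdsWithin] with h hh
        have hh : 0 < h := hh
        simp only [Function.comp]
        rw [norm_smul, norm_of_nonneg (sqrt_nonneg _), mul_pow, sq_sqrt (by positivity)]
        ring
    have h3 := h2.tendsto_div_nhds_zero.add_const (B z z)
    rw [zero_add] at h3
    refine h3.congr' ?_
    filter_upwards [self_mem_nhdsWithin] with h hh
    have hh : h ≠ 0 := ne_of_gt hh
    field_simp
    ring

lemma hasDerivAt_heatKernel {r : ℝ} (hr : 0 < r) (y : EuclideanSpace ℝ (Fin d)) :
    HasDerivAt (fun r => heatKernel d r y)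
      ((4 * π) * (-(d : ℝ) / 2) * (4 * π * r) ^ (-(d : ℝ) / 2 - 1) * rexp (-‖y‖ ^ 2 / (4 * r)) +
        (4 * π * r) ^ (-(d : ℝ) / 2) *
          (rexp (-‖y‖ ^ 2 / (4 * r)) * (‖y‖ ^ 2 / (4 * r ^ 2)))) r := by
  unfold heatKernel
  have h1 : HasDerivAt (fun r : ℝ => 4 * π * r) (4 * π) r := by
    simpa using (hasDerivAt_id r).const_mul (4 * π)
  have h2 : HasDerivAt (fun r : ℝ => 4 * r) 4 r := by
    simpa using (hasDerivAt_id r).const_mul 4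
  have h3 : HasDerivAt (fun r : ℝ => -‖y‖ ^ 2 / (4 * r)) (‖y‖ ^ 2 / (4 * r ^ 2)) r := by
    refine ((hasDerivAt_const r (-‖y‖ ^ 2)).div h2 (by positivity)).congr_deriv ?_
    field_simp
    ring
  exact (h1.rpow_const (Or.inl (by positivity))).mul h3.exp

/-- Near `r₀ > 0`, the time derivative of the heat kernel is dominated by a fixed Gaussian. -/
lemma exists_abs_deriv_heatKernel_le {r₀ : ℝ} (hr₀ : 0 < r₀) :
    ∃ C, ∀ r ∈ Set.Ioo (r₀ / 2) (2 * r₀), ∀ y : EuclideanSpace ℝ (Fin d),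
      |deriv (fun r => heatKernel d r y) r| ≤ C * rexp (-(16 * r₀)⁻¹ * ‖y‖ ^ 2) := by
  set A := (4 * π * (r₀ / 2)) ^ (-(d : ℝ) / 2 - 1)
  set A' := (4 * π * (r₀ / 2)) ^ (-(d : ℝ) / 2)
  refine ⟨4 * π * (d / 2) * A + A' * (16 / r₀), fun r hr y => ?_⟩
  obtain ⟨hr1, hr2⟩ := hr
  have hr : 0 < r := by linarith
  rw [(hasDerivAt_heatKernel hr y).deriv]
  have hd : (0 : ℝ) ≤ d := Nat.cast_nonneg d
  have hA : (4 * π * r) ^ (-(d : ℝ) / 2 - 1) ≤ A :=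
    rpow_le_rpow_of_nonpos (by positivity) (by gcongr) (by linarith)
  have hA' : (4 * π * r) ^ (-(d : ℝ) / 2) ≤ A' :=
    rpow_le_rpow_of_nonpos (by positivity) (by gcongr) (by linarith)
  set b := (16 * r₀)⁻¹
  have hb : 0 < b := by positivity
  have hE : rexp (-‖y‖ ^ 2 / (4 * r)) ≤ rexp (-b * ‖y‖ ^ 2) * rexp (-b * ‖y‖ ^ 2) := by
    rw [← Real.exp_add]
    refine Real.exp_le_exp.2 ?_
    have : 2 * b ≤ (4 * r)⁻¹ := by
      rw [show 2 * b = (8 * r₀)⁻¹ by simp only [b]; field_simp; norm_num]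
      exact inv_anti₀ (by positivity) (by linarith)
    have := mul_le_mul_of_nonneg_right this (sq_nonneg ‖y‖)
    rw [neg_div, div_eq_inv_mul]
    linarith
  have hE1 : rexp (-b * ‖y‖ ^ 2) ≤ 1 := Real.exp_le_one_iff.2 (by
    have := mul_nonneg hb.le (sq_nonneg ‖y‖); linarith)
  have hE2 : rexp (-b * ‖y‖ ^ 2) * ‖y‖ ^ 2 ≤ 16 * r₀ := by
    have h := Real.add_one_le_exp (b * ‖y‖ ^ 2)
    have h' : rexp (-b * ‖y‖ ^ 2) * (b * ‖y‖ ^ 2) ≤ 1 := by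
      rw [neg_mul, Real.exp_neg, inv_mul_le_iff₀ (Real.exp_pos _)]
      linarith
    have : ‖y‖ ^ 2 = 16 * r₀ * (b * ‖y‖ ^ 2) := by simp only [b]; field_simp
    rw [this, mul_left_comm]
    calc _ ≤ 16 * r₀ * 1 := by rw [← this]; gcongr
      _ = _ := mul_one _
  have hinv : (4 * r ^ 2)⁻¹ ≤ (r₀ ^ 2)⁻¹ := by
    gcongr
    nlinarith
  set E := rexp (-b * ‖y‖ ^ 2)
  have hE0 : 0 ≤ E := (Real.exp_pos _).le
  have t1 : |4 * π * (-(d : ℝ) / 2) * (4 * π * r) ^ (-(d : ℝ) / 2 - 1) *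
      rexp (-‖y‖ ^ 2 / (4 * r))| ≤ 4 * π * (d / 2) * A * E := by
    rw [abs_mul, abs_mul, abs_mul, abs_of_nonneg (by positivity : 0 ≤ 4 * π), neg_div, abs_neg,
      abs_of_nonneg (by positivity : (0 : ℝ) ≤ d / 2), Real.abs_exp, ← neg_div,
      abs_of_nonneg (by positivity : 0 ≤ (4 * π * r) ^ (-(d : ℝ) / 2 - 1))]
    have : rexp (-‖y‖ ^ 2 / (4 * r)) ≤ E := hE.trans (mul_le_of_le_one_left hE0 hE1)
    gcongr
  have t2 : |(4 * π * r) ^ (-(d : ℝ) / 2) *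
      (rexp (-‖y‖ ^ 2 / (4 * r)) * (‖y‖ ^ 2 / (4 * r ^ 2)))| ≤ A' * (16 / r₀) * E := by
    rw [abs_of_nonneg (by positivity)]
    have : rexp (-‖y‖ ^ 2 / (4 * r)) * (‖y‖ ^ 2 / (4 * r ^ 2)) ≤ (16 / r₀) * E := by
      calc _ ≤ E * E * (‖y‖ ^ 2 * (r₀ ^ 2)⁻¹) := by
            rw [div_eq_mul_inv (‖y‖ ^ 2)]
            exact mul_le_mul hE (mul_le_mul_of_nonneg_left hinv (sq_nonneg _)) (by positivity)
              (by positivity)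
        _ = (E * ‖y‖ ^ 2) * (E * (r₀ ^ 2)⁻¹) := by ring
        _ ≤ (16 * r₀) * (E * (r₀ ^ 2)⁻¹) := by gcongr
        _ = _ := by field_simp
    rw [mul_assoc A']
    exact mul_le_mul hA' this (by positivity) (by positivity)
  rw [add_mul]
  exact (abs_add_le _ _).trans (add_le_add t1 t2)

lemma differentiableAt_heatSemigroup {φ : EuclideanSpace ℝ (Fin d) → ℝ} (hφ : Continuous φ) {M : ℝ}
    (hM : ∀ x, |φ x| ≤ M) (x : EuclideanSpace ℝ (Fin d)) {r₀ : ℝ} (hr₀ : 0 < r₀) :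
    DifferentiableAt ℝ (fun r => heatSemigroup r φ x) r₀ := by
  obtain ⟨C, hC⟩ := exists_abs_deriv_heatKernel_le (d := d) hr₀
  have hcont : ∀ r, Continuous (fun y => heatKernel d r (x - y) * φ y) := fun r =>
    ((continuous_heatKernel r).comp (continuous_const.sub continuous_id)).mul hφ
  have hs : Set.Ioo (r₀ / 2) (2 * r₀) ∈ 𝓝 r₀ := Ioo_mem_nhds (by linarith) (by linarith)
  have key := hasDerivAt_integral_of_dominated_loc_of_deriv_le (μ := volume)
    (F := fun r y => heatKernel d r (x - y) * φ y)
    (F' := fun r y => deriv (fun r => heatKernel d r (x - y)) r * φ y)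
    (bound := fun y => C * rexp (-(16 * r₀)⁻¹ * ‖x - y‖ ^ 2) * M) hs
    (Eventually.of_forall fun r => (hcont r).aestronglyMeasurable)
    (((integrable_heatKernel hr₀).comp_sub_left x).mul_bdd (c := M) hφ.aestronglyMeasurable
      (Eventually.of_forall hM)) ?_ ?_ ?_ ?_
  · refine key.2.differentiableAt.congr_of_eventuallyEq ?_
    filter_upwards [eventually_gt_nhds hr₀] with r hr
    exact heatSemigroup_eq_integral_heatKernel hr hφ.measurable x
  · refine AEStronglyMeasurable.mul ?_ hφ.aestronglyMeasurable
    simp_rw [(hasDerivAt_heatKernel hr₀ _).deriv]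
    fun_prop
  · refine Eventually.of_forall fun y r hr => ?_
    rw [norm_mul]
    exact mul_le_mul (hC r hr _) (hM y) (norm_nonneg _) ((abs_nonneg _).trans (hC r hr _))
  · exact (((integrable_exp_neg_mul_sq_norm (d := d) (b := (16 * r₀)⁻¹)
      (by positivity)).comp_sub_left x).const_mul C).mul_const M
  · refine Eventually.of_forall fun y r hr => ?_
    have hr' : 0 < r := by linarith [hr.1]
    exact (hasDerivAt_heatKernel hr' (x - y)).differentiableAt.hasDerivAt.mul_const (φ y)

lemma heatSemigroup_sub_le_of_forall {φ ψ : EuclideanSpace ℝ (Fin d) → ℝ} (hφ : Continuous φ)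
    (hψ : Continuous ψ) {M N : ℝ} (hM : ∀ x, |φ x| ≤ M) (hN : ∀ x, |ψ x| ≤ N)
    {x : EuclideanSpace ℝ (Fin d)} {ε : ℝ}
    (h : ∀ y, φ y - φ x - ε * (‖y‖ ^ 2 - ‖x‖ ^ 2) ≤ ψ y - ψ x) {r : ℝ} (hr : 0 ≤ r) :
    heatSemigroup r φ x - φ x -
        ε * (2 * r * ∫ z, ‖z‖ ^ 2 ∂(stdGaussian (EuclideanSpace ℝ (Fin d)))) ≤
      heatSemigroup r ψ x - ψ x := by
  set γ := stdGaussian (EuclideanSpace ℝ (Fin d))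
  set L : EuclideanSpace ℝ (Fin d) →L[ℝ] ℝ := innerSL ℝ x with hL
  have hφi : Integrable (fun z => φ (x + √(2 * r) • z) - φ x) γ :=
    (integrable_comp_add_smul hφ hM x √(2 * r)).sub (integrable_const _)
  have hψi : Integrable (fun z => ψ (x + √(2 * r) • z) - ψ x) γ :=
    (integrable_comp_add_smul hψ hN x √(2 * r)).sub (integrable_const _)
  have hsq : Integrable (fun z : EuclideanSpace ℝ (Fin d) => 2 * r * ‖z‖ ^ 2) γ :=
    integrable_norm_sq_stdGaussian.const_mul _
  have hin : Integrable (fun z => 2 * √(2 * r) * L z) γ :=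
    (IsGaussian.integrable_dual γ L).const_mul _
  have hquad : Integrable (fun z => ε * (2 * √(2 * r) * L z + 2 * r * ‖z‖ ^ 2)) γ :=
    (hin.add hsq).const_mul ε
  have hexp : ∀ z : EuclideanSpace ℝ (Fin d), ‖x + √(2 * r) • z‖ ^ 2 - ‖x‖ ^ 2 =
      2 * √(2 * r) * L z + 2 * r * ‖z‖ ^ 2 := fun z => by
    rw [norm_add_sq_real, norm_smul, inner_smul_right, mul_pow, norm_eq_abs, sq_abs,
      Real.sq_sqrt (by positivity), hL, innerSL_apply_apply]
    ring
  have hmean : ∫ z, 2 * √(2 * r) * L z ∂γ = 0 := by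
    simp [integral_const_mul, γ]
  have hmono := integral_mono (hφi.sub hquad) hψi (fun z => by
    have := h (x + √(2 * r) • z)
    rwa [hexp] at this)
  simp only [Pi.sub_apply] at hmono
  rw [integral_sub hφi hquad, integral_sub (integrable_comp_add_smul hφ hM x _)
      (integrable_const _), integral_sub (integrable_comp_add_smul hψ hN x _) (integrable_const _),
    integral_const_mul, integral_add hin hsq, hmean, integral_const_mul] at hmono
  simpa [heatSemigroup, γ] using hmono

/-- Maximum principle for the heat equation with bounded forcing, in Duhamel form. -/
lemma le_heatSemigroup_add_of_deriv_sub_laplacian_le_Ioc {a b K M : ℝ} (hab : a ≤ b) (hK : 0 ≤ K)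
    {v : ℝ → EuclideanSpace ℝ (Fin d) → ℝ}
    (hcont : ContinuousOn (fun p : ℝ × EuclideanSpace ℝ (Fin d) => v p.1 p.2)
      (Set.Icc a b ×ˢ Set.univ))
    (hM : ∀ t ∈ Set.Icc a b, ∀ x, |v t x| ≤ M)
    (hdiff : ∀ t ∈ Set.Ioc a b, ∀ x, DifferentiableAt ℝ (fun s => v s x) t)
    (hC2 : ∀ t ∈ Set.Ioc a b, ∀ x, ContDiffAt ℝ 2 (v t) x)
    (hle : ∀ t ∈ Set.Ioc a b, ∀ x, deriv (fun s => v s x) t - laplacian (v t) x ≤ K)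
    (x : EuclideanSpace ℝ (Fin d)) :
    v b x ≤ heatSemigroup (b - a) (v a) x + K * (b - a) := by
  set C := ∫ z, ‖z‖ ^ 2 ∂(stdGaussian (EuclideanSpace ℝ (Fin d)))
  have hC : 0 ≤ C := integral_nonneg fun z => by positivity
  have hvc : ∀ t ∈ Set.Icc a b, Continuous (v t) := fun t ht =>
    continuousOn_univ.1 (hcont.comp (f := fun y => (t, y)) (by fun_prop) fun y _ => ⟨ht, trivial⟩)
  have ha : a ∈ Set.Icc a b := ⟨le_rfl, hab⟩
  have hM0 : 0 ≤ M := (abs_nonneg _).trans (hM a ha 0)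
  have hVc : Continuous fun p : ℝ × EuclideanSpace ℝ (Fin d) =>
      heatSemigroup (p.1 - a) (v a) p.2 :=
    (continuous_heatSemigroup (hvc a ha) (hM a ha)).comp
      (f := fun p : ℝ × EuclideanSpace ℝ (Fin d) => (p.1 - a, p.2)) (by fun_prop)
  have hVM : ∀ t y, |heatSemigroup (t - a) (v a) y| ≤ M := fun t y =>
    abs_heatSemigroup_le (hM a ha) y
  have key : ∀ ε > 0, v b x ≤ heatSemigroup (b - a) (v a) x + K * (b - a) +
      ε * (‖x‖ ^ 2 + (2 * C + 1) * (b - a)) := by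
    intro ε hε
    by_contra! hlt
    set z : ℝ × EuclideanSpace ℝ (Fin d) → ℝ := fun p =>
      v p.1 p.2 - heatSemigroup (p.1 - a) (v a) p.2 - K * (p.1 - a) -
        ε * (‖p.2‖ ^ 2 + (2 * C + 1) * (p.1 - a)) with hz
    have hzpos : 0 < z (b, x) := by simp only [hz]; linarith
    have hzc : ContinuousOn z (Set.Icc a b ×ˢ Set.univ) :=
      ((hcont.sub hVc.continuousOn).sub (by fun_prop)).sub (by fun_prop)
    set ρ := 2 * M / ε + 1 with hρ
    have hρ1 : 1 ≤ ρ := by rw [hρ]; linarith [show 0 ≤ 2 * M / ε by positivity]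
    have hout : ∀ t ∈ Set.Icc a b, ∀ y, ρ < ‖y‖ → z (t, y) ≤ 0 := fun t ht y hy => by
      have h1 := (abs_le.1 (hM t ht y)).2
      have h2 := (abs_le.1 (hVM t y)).1
      have h3 : 0 ≤ K * (t - a) := mul_nonneg hK (by linarith [ht.1])
      have h4 : 0 ≤ ε * ((2 * C + 1) * (t - a)) :=
        mul_nonneg hε.le (mul_nonneg (by linarith) (by linarith [ht.1]))
      have h5 : 2 * M ≤ ε * ‖y‖ ^ 2 := by
        have : 2 * M / ε ≤ ‖y‖ ^ 2 := by nlinarith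
        rw [div_le_iff₀ hε] at this
        linarith
      simp only [hz]
      linarith
    have hcomp : IsCompact (Set.Icc a b ×ˢ Metric.closedBall (0 : EuclideanSpace ℝ (Fin d)) ρ) :=
      isCompact_Icc.prod (isCompact_closedBall _ _)
    have hxρ : ‖x‖ ≤ ρ := by
      by_contra! h
      exact (hout b ⟨hab, le_rfl⟩ x h).not_gt hzpos
    obtain ⟨⟨t₀, x₀⟩, ⟨ht₀, -⟩, hmax⟩ := hcomp.exists_isMaxOn ⟨(b, x), ⟨hab, le_rfl⟩, by simpa⟩
      (hzc.mono (Set.prod_mono_right (Set.subset_univ _)))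
    replace ht₀ : t₀ ∈ Set.Icc a b := ht₀
    have hz₀ : 0 < z (t₀, x₀) := hzpos.trans_le (hmax ⟨⟨hab, le_rfl⟩, by simpa⟩)
    have hmax' : ∀ t ∈ Set.Icc a b, ∀ y, z (t, y) ≤ z (t₀, x₀) := fun t ht y => by
      rcases le_or_gt ‖y‖ ρ with h | h
      · exact hmax ⟨ht, by simpa⟩
      · exact (hout t ht y h).trans hz₀.le
    have hat₀ : a < t₀ := by
      rcases ht₀.1.eq_or_lt with h | h
      · exfalso
        simp only [hz, ← h, sub_self, heatSemigroup_zero, mul_zero, add_zero] at hz₀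
        have := mul_nonneg hε.le (sq_nonneg ‖x₀‖)
        linarith
      · exact h
    have ht₀' : t₀ ∈ Set.Ioc a b := ⟨hat₀, ht₀.2⟩
    have hVd : DifferentiableAt ℝ (fun t => heatSemigroup (t - a) (v a) x₀) t₀ :=
      (differentiableAt_heatSemigroup (hvc a ha) (hM a ha) x₀ (sub_pos.2 hat₀)).comp
        (f := fun t => t - a) t₀ (by fun_prop)
    set V' := deriv (fun t => heatSemigroup (t - a) (v a) x₀) t₀
    -- the spatial maximum bounds the time derivative of the caloric function from below
    have hspace : laplacian (v t₀) x₀ - 2 * ε * C ≤ V' := by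
      have h1 := (tendsto_heatSemigroup_sub_div (hvc t₀ ht₀) (hM t₀ ht₀)
        (hC2 t₀ ht₀' x₀)).sub_const (2 * ε * C)
      refine le_of_tendsto_of_tendsto h1 hVd.hasDerivAt.tendsto_slope_zero_right ?_
      filter_upwards [self_mem_nhdsWithin] with h (hh : 0 < h)
      have h2 := heatSemigroup_sub_le_of_forall (hvc t₀ ht₀)
        (ψ := heatSemigroup (t₀ - a) (v a)) (hVc.comp (f := fun y => (t₀, y)) (by fun_prop))
        (hM t₀ ht₀) (hVM t₀) (x := x₀) (ε := ε) (fun y => by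
          have := hmax' t₀ ht₀ y
          simp only [hz] at this
          linarith) hh.le
      rw [heatSemigroup_heatSemigroup hh.le (by linarith) (hvc a ha) (hM a ha)] at h2
      rw [smul_eq_mul, inv_mul_eq_div, show t₀ + h - a = h + (t₀ - a) by ring]
      calc _ = (heatSemigroup h (v t₀) x₀ - v t₀ x₀ - ε * (2 * h * C)) / h := by
            field_simp
        _ ≤ _ := by gcongr
    have htime : 0 ≤ deriv (fun s => v s x₀) t₀ - V' - K - ε * (2 * C + 1) := by
      have hd : HasDerivAt (fun t => z (t, x₀))
          (deriv (fun s => v s x₀) t₀ - V' - K - ε * (2 * C + 1)) t₀ := by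
        have h1 : HasDerivAt (fun t => K * (t - a)) K t₀ := by
          simpa using ((hasDerivAt_id t₀).sub_const a).const_mul K
        have h2 : HasDerivAt (fun t => ε * (‖x₀‖ ^ 2 + (2 * C + 1) * (t - a)))
            (ε * (2 * C + 1)) t₀ := by
          simpa using ((((hasDerivAt_id t₀).sub_const a).const_mul (2 * C + 1)).const_add
            (‖x₀‖ ^ 2)).const_mul ε
        exact (((hdiff t₀ ht₀' x₀).hasDerivAt.sub hVd.hasDerivAt).sub h1).sub h2
      refine ge_of_tendsto hd.tendsto_slope_zero_left ?_
      filter_upwards [Ioo_mem_nhdsLT (show a - t₀ < 0 by linarith)] with h hh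
      have := hmax' (t₀ + h) ⟨by linarith [hh.1], by linarith [hh.2, ht₀.2]⟩ x₀
      exact mul_nonneg_of_nonpos_of_nonpos (inv_nonpos.2 hh.2.le) (by linarith)
    have := hle t₀ ht₀' x₀
    linarith
  have hlim : Tendsto (fun ε => heatSemigroup (b - a) (v a) x + K * (b - a) +
      ε * (‖x‖ ^ 2 + (2 * C + 1) * (b - a))) (𝓝[>] 0)
      (𝓝 (heatSemigroup (b - a) (v a) x + K * (b - a))) :=
    ((Continuous.tendsto' (by fun_prop) 0 _ (by simp)).mono_left nhdsWithin_le_nhds)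
  exact ge_of_tendsto hlim (eventually_mem_nhdsWithin.mono key)

lemma le_heatSemigroup_add_of_deriv_sub_laplacian_le {a b K M : ℝ} (hab : a ≤ b) (hK : 0 ≤ K)
    {v : ℝ → EuclideanSpace ℝ (Fin d) → ℝ}
    (hcont : ContinuousOn (fun p : ℝ × EuclideanSpace ℝ (Fin d) => v p.1 p.2)
      (Set.Icc a b ×ˢ Set.univ))
    (hM : ∀ t ∈ Set.Icc a b, ∀ x, |v t x| ≤ M)
    (hdiff : ∀ t ∈ Set.Ioo a b, ∀ x, DifferentiableAt ℝ (fun s => v s x) t)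
    (hC2 : ∀ t ∈ Set.Ioo a b, ∀ x, ContDiffAt ℝ 2 (v t) x)
    (hle : ∀ t ∈ Set.Ioo a b, ∀ x, deriv (fun s => v s x) t - laplacian (v t) x ≤ K)
    (x : EuclideanSpace ℝ (Fin d)) :
    v b x ≤ heatSemigroup (b - a) (v a) x + K * (b - a) := by
  rcases hab.eq_or_lt with rfl | hlt
  · simp [heatSemigroup_zero]
  have ha : a ∈ Set.Icc a b := ⟨le_rfl, hab⟩
  have hva : Continuous (v a) :=
    continuousOn_univ.1 (hcont.comp (f := fun y => (a, y)) (by fun_prop) fun y _ => ⟨ha, trivial⟩)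
  have hvx : ContinuousOn (fun t => v t x) (Set.Icc a b) :=
    hcont.comp (f := fun t => (t, x)) (by fun_prop) fun t ht => ⟨ht, trivial⟩
  have hl : Tendsto (fun t => v t x) (𝓝[<] b) (𝓝 (v b x)) := by
    rw [← nhdsWithin_Ioo_eq_nhdsLT hlt]
    exact (hvx b ⟨hab, le_rfl⟩).mono_left (nhdsWithin_mono _ Set.Ioo_subset_Icc_self)
  have hr : Tendsto (fun t => heatSemigroup (t - a) (v a) x + K * (t - a)) (𝓝[<] b)
      (𝓝 (heatSemigroup (b - a) (v a) x + K * (b - a))) := by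
    refine (Continuous.tendsto ?_ b).mono_left nhdsWithin_le_nhds
    exact ((continuous_heatSemigroup hva (hM a ha)).comp (f := fun t => (t - a, x))
      (by fun_prop)).add (by fun_prop)
  refine le_of_tendsto_of_tendsto hl hr ?_
  filter_upwards [Ioo_mem_nhdsLT hlt] with t ht
  have hIoc : ∀ s ∈ Set.Ioc a t, s ∈ Set.Ioo a b := fun s hs => ⟨hs.1, hs.2.trans_lt ht.2⟩
  have hIcc : Set.Icc a t ⊆ Set.Icc a b := Set.Icc_subset_Icc_right ht.2.le
  exact le_heatSemigroup_add_of_deriv_sub_laplacian_le_Ioc ht.1.le hK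
    (hcont.mono (Set.prod_mono_left hIcc)) (fun s hs => hM s (hIcc hs))
    (fun s hs => hdiff s (hIoc s hs)) (fun s hs => hC2 s (hIoc s hs))
    (fun s hs => hle s (hIoc s hs)) x

lemma heatSemigroup_neg (r : ℝ) (φ : EuclideanSpace ℝ (Fin d) → ℝ) (x : EuclideanSpace ℝ (Fin d)) :
    heatSemigroup r (fun y => -φ y) x = -heatSemigroup r φ x :=
  integral_neg _

lemma heatSemigroup_sub {φ ψ : EuclideanSpace ℝ (Fin d) → ℝ} (hφ : Continuous φ)
    (hψ : Continuous ψ) {M N : ℝ} (hM : ∀ x, |φ x| ≤ M) (hN : ∀ x, |ψ x| ≤ N) (r : ℝ)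
    (x : EuclideanSpace ℝ (Fin d)) :
    heatSemigroup r (fun y => φ y - ψ y) x = heatSemigroup r φ x - heatSemigroup r ψ x :=
  integral_sub (integrable_comp_add_smul hφ hM x _) (integrable_comp_add_smul hψ hN x _)

lemma heatSemigroup_mono {φ ψ : EuclideanSpace ℝ (Fin d) → ℝ} (hφ : Measurable φ)
    (hψ : Measurable ψ) {M N : ℝ} (hM : ∀ x, |φ x| ≤ M) (hN : ∀ x, |ψ x| ≤ N)
    (h : ∀ y, φ y ≤ ψ y) (r : ℝ) (x : EuclideanSpace ℝ (Fin d)) :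
    heatSemigroup r φ x ≤ heatSemigroup r ψ x := by
  have hm : Measurable fun z : EuclideanSpace ℝ (Fin d) => x + √(2 * r) • z := by fun_prop
  exact integral_mono
    (Integrable.of_bound (hφ.comp hm).aestronglyMeasurable M (Eventually.of_forall fun _ => hM _))
    (Integrable.of_bound (hψ.comp hm).aestronglyMeasurable N (Eventually.of_forall fun _ => hN _))
    fun _ => h _

lemma laplacian_neg (φ : EuclideanSpace ℝ (Fin d) → ℝ) (x : EuclideanSpace ℝ (Fin d)) :
    laplacian (fun y => -φ y) x = -laplacian φ x := by
  simp [laplacian, fderiv_fun_neg]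

lemma abs_sub_heatSemigroup_le {a b K M : ℝ} (hab : a ≤ b) (hK : 0 ≤ K)
    {v : ℝ → EuclideanSpace ℝ (Fin d) → ℝ}
    (hcont : ContinuousOn (fun p : ℝ × EuclideanSpace ℝ (Fin d) => v p.1 p.2)
      (Set.Icc a b ×ˢ Set.univ))
    (hM : ∀ t ∈ Set.Icc a b, ∀ x, |v t x| ≤ M)
    (hdiff : ∀ t ∈ Set.Ioo a b, ∀ x, DifferentiableAt ℝ (fun s => v s x) t)
    (hC2 : ∀ t ∈ Set.Ioo a b, ∀ x, ContDiffAt ℝ 2 (v t) x)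
    (hle : ∀ t ∈ Set.Ioo a b, ∀ x, |deriv (fun s => v s x) t - laplacian (v t) x| ≤ K)
    (x : EuclideanSpace ℝ (Fin d)) :
    |v b x - heatSemigroup (b - a) (v a) x| ≤ K * (b - a) := by
  have h1 := le_heatSemigroup_add_of_deriv_sub_laplacian_le hab hK hcont hM hdiff hC2
    (fun t ht y => (abs_le.1 (hle t ht y)).2) x
  have h2 := le_heatSemigroup_add_of_deriv_sub_laplacian_le hab hK (v := fun t y => -v t y)
    hcont.neg (fun t ht y => by rw [abs_neg]; exact hM t ht y) (fun t ht y => (hdiff t ht y).neg)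
    (fun t ht y => (hC2 t ht y).neg) (fun t ht y => by
      have := (abs_le.1 (hle t ht y)).1
      rw [deriv.fun_neg, laplacian_neg]
      linarith) x
  rw [heatSemigroup_neg] at h2
  rw [abs_le]
  constructor <;> linarith

/-- Kato's inequality for difference quotients. -/
lemma tendsto_max_abs_sub_abs_div {p q : ℝ → ℝ} {m f ρ : ℝ} (hp : Tendsto p (𝓝[>] 0) (𝓝 m))
    (hq : Tendsto q (𝓝[>] 0) (𝓝 m))
    (hpq : Tendsto (fun h => (p h - q h) / h) (𝓝[>] 0) (𝓝 f))
    (hpos : 0 ≤ m → f ≤ ρ) (hneg : m ≤ 0 → -f ≤ ρ) :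
    Tendsto (fun h => max ((|p h| - |q h|) / h) ρ) (𝓝[>] 0) (𝓝 ρ) := by
  rcases lt_trichotomy m 0 with hm | hm | hm
  · have := (hpq.neg).max (tendsto_const_nhds (x := ρ))
    rw [max_eq_right (hneg hm.le)] at this
    refine this.congr' ?_
    filter_upwards [hp.eventually_lt_const hm, hq.eventually_lt_const hm] with h h1 h2
    rw [abs_of_neg h1, abs_of_neg h2, ← neg_div]
    ring_nf
  · have := (hpq.abs).max (tendsto_const_nhds (x := ρ))
    rw [max_eq_right (abs_le'.2 ⟨hpos hm.ge, hneg hm.le⟩)] at this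
    refine tendsto_of_tendsto_of_tendsto_of_le_of_le' tendsto_const_nhds this
      (Eventually.of_forall fun h => le_max_right _ _) ?_
    filter_upwards [self_mem_nhdsWithin] with h (hh : 0 < h)
    refine max_le_max ?_ le_rfl
    rw [abs_div, abs_of_pos hh]
    gcongr
    exact abs_sub_abs_le_abs_sub _ _
  · have := hpq.max (tendsto_const_nhds (x := ρ))
    rw [max_eq_right (hpos hm.le)] at this
    refine this.congr' ?_
    filter_upwards [hp.eventually_const_lt hm, hq.eventually_const_lt hm] with h h1 h2
    rw [abs_of_pos h1, abs_of_pos h2]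

lemma tendsto_heatSemigroup_sub {g : ℝ → EuclideanSpace ℝ (Fin d) → ℝ}
    {ρ : EuclideanSpace ℝ (Fin d) → ℝ} {K τ : ℝ} (hτ : 0 < τ)
    (hg : ∀ᶠ h in 𝓝[>] 0, Measurable (g h)) (hK : ∀ᶠ h in 𝓝[>] 0, ∀ y, |g h y| ≤ K)
    (hlim : ∀ y, Tendsto (fun h => g h y) (𝓝[>] 0) (𝓝 (ρ y))) (x : EuclideanSpace ℝ (Fin d)) :
    Tendsto (fun h => heatSemigroup (τ - h) (g h) x) (𝓝[>] 0)
      (𝓝 (∫ y, heatKernel d τ (x - y) * ρ y)) := by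
  have hnear : ∀ᶠ h : ℝ in 𝓝[>] 0, h ∈ Set.Ioo 0 (τ / 2) := Ioo_mem_nhdsGT (by linarith)
  have hrepr : ∀ᶠ h in 𝓝[>] 0,
      ∫ y, heatKernel d (τ - h) (x - y) * g h y = heatSemigroup (τ - h) (g h) x := by
    filter_upwards [hnear, hg] with h hh hgh
    exact (heatSemigroup_eq_integral_heatKernel (by linarith [hh.2]) hgh x).symm
  refine Tendsto.congr' hrepr ?_
  set A := (4 * π * (τ / 2)) ^ (-(d : ℝ) / 2)
  refine tendsto_integral_filter_of_dominated_convergence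
    (fun y => A * rexp (-(4 * τ)⁻¹ * ‖x - y‖ ^ 2) * K) ?_ ?_ ?_ ?_
  · filter_upwards [hg] with h hgh
    exact ((continuous_heatKernel _).measurable.comp
      (measurable_const_sub x)).mul hgh |>.aestronglyMeasurable
  · filter_upwards [hnear, hK] with h hh hKh
    refine Eventually.of_forall fun y => ?_
    have hr : 0 < τ - h := by linarith [hh.2]
    have h1 : heatKernel d (τ - h) (x - y) ≤ A * rexp (-(4 * τ)⁻¹ * ‖x - y‖ ^ 2) := by
      unfold heatKernel
      have hA : (4 * π * (τ - h)) ^ (-(d : ℝ) / 2) ≤ A :=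
        rpow_le_rpow_of_nonpos (by positivity) (by gcongr; linarith [hh.2])
          (by have : (0 : ℝ) ≤ d := Nat.cast_nonneg d
              linarith)
      have hE : (4 * τ)⁻¹ ≤ (4 * (τ - h))⁻¹ := inv_anti₀ (by positivity) (by linarith [hh.1])
      gcongr
      rw [neg_div, neg_mul, neg_le_neg_iff, div_eq_inv_mul]
      gcongr
    rw [norm_mul, norm_of_nonneg (heatKernel_nonneg hr.le _)]
    exact mul_le_mul h1 (hKh y) (norm_nonneg _) ((heatKernel_nonneg hr.le _).trans h1)
  · exact (((integrable_exp_neg_mul_sq_norm (d := d) (b := (4 * τ)⁻¹)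
      (by positivity)).comp_sub_left x).const_mul A).mul_const K
  · refine Eventually.of_forall fun y => Tendsto.mul ?_ (hlim y)
    refine (hasDerivAt_heatKernel hτ (x - y)).continuousAt.tendsto.comp ?_
    exact (Continuous.tendsto' (by fun_prop) 0 _ (by simp)).mono_left nhdsWithin_le_nhds

/-- If `m` vanishes initially and `(∂ₜ - Δ) m` is bounded and, in the direction of the sign of `m`,
at most `ρ`, then `|m|` is at most the Duhamel integral of `ρ`. -/
lemma abs_le_integral_heatKernel_mul {t K M : ℝ} (ht : 0 < t)
    {m ρ : ℝ → EuclideanSpace ℝ (Fin d) → ℝ}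
    (hcont : ContinuousOn (fun p : ℝ × EuclideanSpace ℝ (Fin d) => m p.1 p.2)
      (Set.Icc 0 t ×ˢ Set.univ))
    (hM : ∀ s ∈ Set.Icc 0 t, ∀ x, |m s x| ≤ M)
    (hdiff : ∀ s ∈ Set.Ioo 0 t, ∀ x, DifferentiableAt ℝ (fun r => m r x) s)
    (hC2 : ∀ s ∈ Set.Ioo 0 t, ∀ x, ContDiffAt ℝ 2 (m s) x)
    (hle : ∀ s ∈ Set.Ioo 0 t, ∀ x, |deriv (fun r => m r x) s - laplacian (m s) x| ≤ K)
    (h0 : ∀ x, m 0 x = 0)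
    (hρm : Measurable (fun p : ℝ × EuclideanSpace ℝ (Fin d) => ρ p.1 p.2))
    (hρ : ∀ s ∈ Set.Ioo 0 t, ∀ x, |ρ s x| ≤ K)
    (hpos : ∀ s ∈ Set.Ioo 0 t, ∀ x, 0 ≤ m s x →
      deriv (fun r => m r x) s - laplacian (m s) x ≤ ρ s x)
    (hneg : ∀ s ∈ Set.Ioo 0 t, ∀ x, m s x ≤ 0 →
      -(deriv (fun r => m r x) s - laplacian (m s) x) ≤ ρ s x)
    (x : EuclideanSpace ℝ (Fin d)) :
    |m t x| ≤ ∫ s in (0 : ℝ)..t, ∫ y, heatKernel d (t - s) (x - y) * ρ s y := by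
  have hK : 0 ≤ K := (abs_nonneg _).trans (hρ (t / 2) ⟨by linarith, by linarith⟩ x)
  have hmc : ∀ s ∈ Set.Icc 0 t, Continuous (m s) := fun s hs =>
    continuousOn_univ.1 (hcont.comp (f := fun y => (s, y)) (by fun_prop) fun y _ => ⟨hs, trivial⟩)
  have hMabs : ∀ s ∈ Set.Icc 0 t, ∀ y, |(|m s y|)| ≤ M := fun s hs y => by
    rw [abs_abs]; exact hM s hs y
  have hPc : ∀ r, ∀ s ∈ Set.Icc 0 t, Continuous (heatSemigroup r (m s)) := fun r s hs =>
    (continuous_heatSemigroup (hmc s hs) (hM s hs)).comp (f := fun y => (r, y)) (by fun_prop)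
  have hPM : ∀ r, ∀ s ∈ Set.Icc 0 t, ∀ y, |(|heatSemigroup r (m s) y|)| ≤ M := fun r s hs y => by
    rw [abs_abs]; exact abs_heatSemigroup_le (hM s hs) y
  have hstep : ∀ s ∈ Set.Icc 0 t, ∀ s' ∈ Set.Icc 0 t, s ≤ s' → ∀ y,
      |m s' y - heatSemigroup (s' - s) (m s) y| ≤ K * (s' - s) := fun s hs s' hs' hss y =>
    abs_sub_heatSemigroup_le hss hK
      (hcont.mono (Set.prod_mono_left (Set.Icc_subset_Icc hs.1 hs'.2)))
      (fun r hr => hM r (Set.Icc_subset_Icc hs.1 hs'.2 hr))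
      (fun r hr => hdiff r (Set.Ioo_subset_Ioo hs.1 hs'.2 hr))
      (fun r hr => hC2 r (Set.Ioo_subset_Ioo hs.1 hs'.2 hr))
      (fun r hr => hle r (Set.Ioo_subset_Ioo hs.1 hs'.2 hr)) y
  set e : ℝ → ℝ → EuclideanSpace ℝ (Fin d) → ℝ := fun s s' y =>
    |m s' y| - |heatSemigroup (s' - s) (m s) y| with he
  have hebound : ∀ s ∈ Set.Icc 0 t, ∀ s' ∈ Set.Icc 0 t, s ≤ s' → ∀ y,
      |e s s' y| ≤ K * (s' - s) := fun s hs s' hs' hss y =>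
    (abs_abs_sub_abs_le_abs_sub _ _).trans (hstep s hs s' hs' hss y)
  have hec : ∀ s ∈ Set.Icc 0 t, ∀ s' ∈ Set.Icc 0 t, Continuous (e s s') := fun s hs s' hs' =>
    (hmc s' hs').abs.sub (hPc _ s hs).abs
  set Ψ : ℝ → ℝ := fun s => heatSemigroup (t - s) (fun y => |m s y|) x with hΨ
  have hincr : ∀ s ∈ Set.Icc 0 t, ∀ s' ∈ Set.Icc 0 t, s ≤ s' →
      Ψ s' - Ψ s ≤ heatSemigroup (t - s') (e s s') x := by
    intro s hs s' hs' hss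
    have h1 : Ψ s = heatSemigroup (t - s')
        (heatSemigroup (s' - s) (fun y => |m s y|)) x := by
      rw [heatSemigroup_heatSemigroup (by linarith [hs'.2]) (by linarith) (hmc s hs).abs
        (hMabs s hs)]
      simp only [hΨ]
      congr 1
      ring
    have h2 : heatSemigroup (t - s') (fun y => |heatSemigroup (s' - s) (m s) y|) x ≤ Ψ s := by
      rw [h1]
      refine heatSemigroup_mono (hPc _ s hs).abs.measurable ?_ (hPM _ s hs)
        (fun y => abs_heatSemigroup_le (hMabs s hs) y)
        (fun y => abs_heatSemigroup_le_abs _ _ y) _ x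
      exact ((continuous_heatSemigroup (hmc s hs).abs (hMabs s hs)).comp
        (f := fun y => (s' - s, y)) (by fun_prop)).measurable
    have h3 := heatSemigroup_sub (hmc s' hs').abs (hPc (s' - s) s hs).abs (hMabs s' hs')
      (hPM _ s hs) (t - s') x
    simp only [he, h3, hΨ] at h2 ⊢
    linarith
  set F : ℝ → ℝ := fun s => K * s - Ψ s with hF
  have hFmono : MonotoneOn F (Set.uIcc 0 t) := by
    rw [Set.uIcc_of_le ht.le]
    intro s hs s' hs' hss
    have h1 := hincr s hs s' hs' hss
    have h2 := (abs_le.1 (abs_heatSemigroup_le (r := t - s') (hebound s hs s' hs' hss) x)).2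
    simp only [hF]
    linarith
  set k : ℝ → ℝ := fun s => ∫ y, heatKernel d (t - s) (x - y) * ρ s y with hk
  have hρms : ∀ s, Measurable (ρ s) := fun s => hρm.comp (measurable_prodMk_left)
  have hderiv : ∀ s ∈ Set.Ioo 0 t, DifferentiableAt ℝ F s → K - k s ≤ deriv F s := by
    intro s hs hFd
    have hs' : s ∈ Set.Icc 0 t := Set.Ioo_subset_Icc_self hs
    have hnear : ∀ᶠ h : ℝ in 𝓝[>] 0, h ∈ Set.Ioo 0 (t - s) :=
      Ioo_mem_nhdsGT (by linarith [hs.2])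
    have hmem : ∀ h ∈ Set.Ioo 0 (t - s), s + h ∈ Set.Icc 0 t := fun h hh =>
      ⟨by linarith [hs.1, hh.1], by linarith [hh.2]⟩
    set g : ℝ → EuclideanSpace ℝ (Fin d) → ℝ := fun h y => max (e s (s + h) y / h) (ρ s y)
    have hgm : ∀ h ∈ Set.Ioo 0 (t - s), Measurable (g h) := fun h hh =>
      ((hec s hs' _ (hmem h hh)).measurable.div_const h).max (hρms s)
    have hediv : ∀ h ∈ Set.Ioo 0 (t - s), ∀ y, |e s (s + h) y / h| ≤ K := fun h hh y => by
      rw [abs_div, abs_of_pos hh.1, div_le_iff₀ hh.1]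
      have := hebound s hs' _ (hmem h hh) (by linarith [hh.1]) y
      rwa [add_sub_cancel_left] at this
    have hgK : ∀ h ∈ Set.Ioo 0 (t - s), ∀ y, |g h y| ≤ K := fun h hh y =>
      abs_max_le_max_abs_abs.trans (max_le (hediv h hh y) (hρ s hs y))
    have hglim : ∀ y, Tendsto (fun h => g h y) (𝓝[>] 0) (𝓝 (ρ s y)) := by
      intro y
      have htime := (hdiff s hs y).hasDerivAt.tendsto_slope_zero_right
      have hgen := tendsto_heatSemigroup_sub_div (hmc s hs') (hM s hs') (hC2 s hs y)
      have hshift : Tendsto (fun h => m (s + h) y) (𝓝[>] 0) (𝓝 (m s y)) :=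
        (hdiff s hs y).continuousAt.tendsto.comp
          ((Continuous.tendsto' (by fun_prop) 0 _ (by simp)).mono_left nhdsWithin_le_nhds)
      have hP : Tendsto (fun h => heatSemigroup h (m s) y) (𝓝[>] 0) (𝓝 (m s y)) :=
        (((continuous_heatSemigroup (hmc s hs') (hM s hs')).comp
          (f := fun h : ℝ => (h, y)) (by fun_prop)).tendsto' 0 _
          (by simp [heatSemigroup_zero])).mono_left nhdsWithin_le_nhds
      simp only [g, he, add_sub_cancel_left]
      refine tendsto_max_abs_sub_abs_div hshift hP ((htime.sub hgen).congr fun h => ?_)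
        (hpos s hs y) (hneg s hs y)
      rw [smul_eq_mul, inv_mul_eq_div]
      ring
    have hlim := tendsto_heatSemigroup_sub (sub_pos.2 hs.2) (hnear.mono hgm) (hnear.mono hgK)
      hglim x
    refine le_of_tendsto_of_tendsto (hlim.const_sub K) hFd.hasDerivAt.tendsto_slope_zero_right ?_
    filter_upwards [hnear] with h hh
    have h1 := hincr s hs' _ (hmem h hh) (by linarith [hh.1])
    have h2 := heatSemigroup_mono ((hec s hs' _ (hmem h hh)).measurable.div_const h) (hgm h hh)
      (hediv h hh) (hgK h hh) (fun y => le_max_left _ _) (t - (s + h)) x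
    have h3 : heatSemigroup (t - (s + h)) (fun y => e s (s + h) y / h) x =
        heatSemigroup (t - (s + h)) (e s (s + h)) x / h := integral_div _ _
    rw [h3, div_le_iff₀ hh.1, ← sub_sub] at h2
    rw [← sub_sub] at h1
    rw [smul_eq_mul, inv_mul_eq_div, le_div_iff₀ hh.1]
    simp only [hF]
    linarith
  have hkm : StronglyMeasurable k := by
    refine StronglyMeasurable.integral_prod_right (f := fun s y =>
      heatKernel d (t - s) (x - y) * ρ s y) (Measurable.stronglyMeasurable ?_)
    refine Measurable.mul ?_ hρm
    unfold heatKernel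
    fun_prop
  have hkK : ∀ s ∈ Set.Ioo 0 t, |k s| ≤ K := fun s hs => by
    simp only [hk]
    rw [← heatSemigroup_eq_integral_heatKernel (sub_pos.2 hs.2) (hρms s)]
    exact abs_heatSemigroup_le (hρ s hs) x
  have hki : IntervalIntegrable k volume 0 t := by
    rw [intervalIntegrable_iff_integrableOn_Ioo_of_le ht.le]
    refine Integrable.of_bound hkm.aestronglyMeasurable K ?_
    filter_upwards [ae_restrict_mem measurableSet_Ioo] with s hs using hkK s hs
  have hmono : ∫ s in (0 : ℝ)..t, (K - k s) ≤ ∫ s in (0 : ℝ)..t, deriv F s := by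
    refine intervalIntegral.integral_mono_ae_restrict ht.le (intervalIntegrable_const.sub hki)
      hFmono.intervalIntegrable_deriv ?_
    rw [EventuallyLE, ← restrict_Ioo_eq_restrict_Icc, ae_restrict_iff' measurableSet_Ioo]
    filter_upwards [hFmono.ae_differentiableWithinAt_of_mem] with s hd hs
    rw [Set.uIcc_of_le ht.le] at hd
    exact hderiv s hs ((hd (Set.Ioo_subset_Icc_self hs)).differentiableAt
      (Icc_mem_nhds hs.1 hs.2))
  have hFt : F t = K * t - |m t x| := by simp [hF, hΨ, heatSemigroup_zero]
  have hF0 : F 0 = 0 := by simp [hF, hΨ, h0, heatSemigroup]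
  have hF0t : F 0 ≤ F t := hFmono Set.left_mem_uIcc Set.right_mem_uIcc ht.le
  have hint := hFmono.intervalIntegral_deriv_mem_uIcc
  rw [Set.uIcc_of_le (by linarith)] at hint
  rw [intervalIntegral.integral_sub intervalIntegrable_const hki,
    intervalIntegral.integral_const] at hmono
  have := hint.2
  rw [hFt, hF0] at this
  simp only [smul_eq_mul] at hmono
  linarith

lemma laplacian_const_mul_sub {φ ψ : EuclideanSpace ℝ (Fin d) → ℝ} {x : EuclideanSpace ℝ (Fin d)}
    (hφ : ContDiffAt ℝ 2 φ x) (hψ : ContDiffAt ℝ 2 ψ x) (c : ℝ) :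
    laplacian (fun y => c * (φ y - ψ y)) x = c * (laplacian φ x - laplacian ψ x) := by
  have hdiff : ∀ {χ : EuclideanSpace ℝ (Fin d) → ℝ}, ContDiffAt ℝ 2 χ x → ∀ v,
      DifferentiableAt ℝ (fun y => fderiv ℝ χ y v) x := fun hχ v =>
    ((hχ.fderiv_right (m := 1) (by norm_num)).differentiableAt (by norm_num)).clm_apply
      (differentiableAt_const v)
  rw [laplacian, laplacian, laplacian, ← Finset.sum_sub_distrib, Finset.mul_sum]
  refine Finset.sum_congr rfl fun i _ => ?_
  set v : EuclideanSpace ℝ (Fin d) := EuclideanSpace.single i 1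
  have hev : (fun y => fderiv ℝ (fun y => c * (φ y - ψ y)) y v) =ᶠ[𝓝 x]
      fun y => c * (fderiv ℝ φ y v - fderiv ℝ ψ y v) := by
    filter_upwards [hφ.eventually (by simp), hψ.eventually (by simp)] with y h1 h2
    have h1 := h1.differentiableAt (by norm_num)
    have h2 := h2.differentiableAt (by norm_num)
    rw [((h1.hasFDerivAt.fun_sub h2.hasFDerivAt).const_mul c).fderiv]
    rfl
  rw [hev.fderiv_eq,
    (((hdiff hφ v).hasFDerivAt.fun_sub (hdiff hψ v).hasFDerivAt).const_mul c).fderiv]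
  rfl

end HeatSemigroup

/-- Remainder bound via comparison: if `u` solves Allen–Cahn, `w` solves Allen–Cahn with
forcing `R` (bounded measurable), both bounded continuous on `[0,T] × ℝ^d`, `C¹` in time and
`C²` in space on `(0,T) × ℝ^d`, with the same initial data, then
`|u(t,x) - w(t,x)| ≤ ∫_0^t e^{t-s} ∫ p_{t-s}(x-y)|R(s,y)| dy ds`. -/
theorem stmt9 (d : ℕ) (hd : 1 ≤ d) (T : ℝ) (hT : 0 < T)
    (u w R : ℝ → EuclideanSpace ℝ (Fin d) → ℝ)
    (hu_cont : ContinuousOn (fun p : ℝ × EuclideanSpace ℝ (Fin d) => u p.1 p.2)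
      (Set.Icc 0 T ×ˢ Set.univ))
    (hw_cont : ContinuousOn (fun p : ℝ × EuclideanSpace ℝ (Fin d) => w p.1 p.2)
      (Set.Icc 0 T ×ˢ Set.univ))
    (hu_bdd : ∃ M : ℝ, ∀ t ∈ Set.Icc 0 T, ∀ x, |u t x| ≤ M)
    (hw_bdd : ∃ M : ℝ, ∀ t ∈ Set.Icc 0 T, ∀ x, |w t x| ≤ M)
    (hu_time : ∀ t ∈ Set.Ioo 0 T, ∀ x, ContDiffAt ℝ 1 (fun s => u s x) t)
    (hu_space : ∀ t ∈ Set.Ioo 0 T, ∀ x, ContDiffAt ℝ 2 (fun y => u t y) x)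
    (hw_time : ∀ t ∈ Set.Ioo 0 T, ∀ x, ContDiffAt ℝ 1 (fun s => w s x) t)
    (hw_space : ∀ t ∈ Set.Ioo 0 T, ∀ x, ContDiffAt ℝ 2 (fun y => w t y) x)
    (h_init : ∀ x, u 0 x = w 0 x)
    (hu_pde : ∀ t ∈ Set.Ioo 0 T, ∀ x,
      deriv (fun s => u s x) t = laplacian (u t) x + u t x - (u t x) ^ 3)
    (hw_pde : ∀ t ∈ Set.Ioo 0 T, ∀ x,
      deriv (fun s => w s x) t = laplacian (w t) x + w t x - (w t x) ^ 3 + R t x)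
    (hR_meas : Measurable (fun p : ℝ × EuclideanSpace ℝ (Fin d) => R p.1 p.2))
    (hR_bdd : ∃ M : ℝ, ∀ t ∈ Set.Ioo 0 T, ∀ x, |R t x| ≤ M) :
    ∀ t ∈ Set.Icc 0 T, ∀ x,
      |u t x - w t x| ≤
        ∫ s in (0:ℝ)..t, Real.exp (t - s) * ∫ y, heatKernel d (t - s) (x - y) * |R s y| := by
  intro t ht x
  obtain ⟨Mu, hMu⟩ := hu_bdd
  obtain ⟨Mw, hMw⟩ := hw_bdd
  obtain ⟨MR, hMR⟩ := hR_bdd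
  rcases ht.1.eq_or_lt with rfl | ht0
  · simp [h_init]
  have hIcc : Set.Icc 0 t ⊆ Set.Icc 0 T := Set.Icc_subset_Icc_right ht.2
  have hIoo : Set.Ioo 0 t ⊆ Set.Ioo 0 T := Set.Ioo_subset_Ioo_right ht.2
  set m : ℝ → EuclideanSpace ℝ (Fin d) → ℝ := fun s y => rexp (-s) * (u s y - w s y) with hm
  have hexp : ∀ s, 0 ≤ s → rexp (-s) ≤ 1 := fun s hs => exp_le_one_iff.2 (by linarith)
  have hforce : ∀ s ∈ Set.Ioo 0 t, ∀ y, deriv (fun r => m r y) s - laplacian (m s) y =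
      -((u s y) ^ 2 + u s y * w s y + (w s y) ^ 2) * m s y - rexp (-s) * R s y := by
    intro s hs y
    have hs' := hIoo hs
    have hu := ((hu_time s hs' y).differentiableAt (by norm_num)).hasDerivAt
    have hw := ((hw_time s hs' y).differentiableAt (by norm_num)).hasDerivAt
    have hd : HasDerivAt (fun r => m r y) _ s :=
      ((hasDerivAt_id s).neg.exp).mul (hu.sub hw)
    rw [hd.deriv, laplacian_const_mul_sub (hu_space s hs' y) (hw_space s hs' y),
      hu_pde s hs' y, hw_pde s hs' y]
    simp only [hm, id_eq, Pi.neg_apply]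
    ring
  have hquad : ∀ s y, 0 ≤ (u s y) ^ 2 + u s y * w s y + (w s y) ^ 2 := fun s y => by
    nlinarith [sq_nonneg (u s y + w s y), sq_nonneg (u s y), sq_nonneg (w s y)]
  have hmM : ∀ s ∈ Set.Icc 0 t, ∀ y, |m s y| ≤ Mu + Mw := fun s hs y => by
    rw [hm, abs_mul, abs_exp]
    calc _ ≤ 1 * |u s y - w s y| := by gcongr; exact hexp s hs.1
      _ ≤ |u s y| + |w s y| := by rw [one_mul]; exact abs_sub _ _
      _ ≤ _ := add_le_add (hMu s (hIcc hs) y) (hMw s (hIcc hs) y)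
  have hρMR : ∀ s ∈ Set.Ioo 0 t, ∀ y, rexp (-s) * |R s y| ≤ MR := fun s hs y =>
    (mul_le_of_le_one_left (abs_nonneg _) (hexp s hs.1.le)).trans (hMR s (hIoo hs) y)
  have hRe : ∀ s y, |rexp (-s) * R s y| = rexp (-s) * |R s y| := fun s y => by
    rw [abs_mul, abs_exp]
  set Q := Mu ^ 2 + Mu * Mw + Mw ^ 2
  have hQ : ∀ s ∈ Set.Icc 0 t, ∀ y, (u s y) ^ 2 + u s y * w s y + (w s y) ^ 2 ≤ Q :=
    fun s hs y => by
      have h1 := hMu s (hIcc hs) y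
      have h2 := hMw s (hIcc hs) y
      have h3 : u s y * w s y ≤ Mu * Mw := (le_abs_self _).trans <| by
        rw [abs_mul]
        exact mul_le_mul h1 h2 (abs_nonneg _) ((abs_nonneg _).trans h1)
      have h4 : (u s y) ^ 2 ≤ Mu ^ 2 := sq_le_sq' (abs_le.1 h1).1 (abs_le.1 h1).2
      have h5 : (w s y) ^ 2 ≤ Mw ^ 2 := sq_le_sq' (abs_le.1 h2).1 (abs_le.1 h2).2
      linarith
  have key := abs_le_integral_heatKernel_mul ht0 (m := m) (ρ := fun s y => rexp (-s) * |R s y|)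
    (K := Q * (Mu + Mw) + MR) (M := Mu + Mw) ?_ hmM ?_ ?_ ?_ (fun y => by simp [hm, h_init]) ?_ ?_
    ?_ ?_ x
  · rw [hm, abs_mul, abs_exp] at key
    calc |u t x - w t x| = rexp t * (rexp (-t) * |u t x - w t x|) := by
          rw [← mul_assoc, ← exp_add]; simp
      _ ≤ rexp t * ∫ s in (0 : ℝ)..t,
          ∫ y, heatKernel d (t - s) (x - y) * (rexp (-s) * |R s y|) := by gcongr
      _ = _ := by
          rw [← intervalIntegral.integral_const_mul]
          congr 1
          ext s
          rw [sub_eq_add_neg t s, exp_add, mul_assoc, ← integral_const_mul (rexp (-s))]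
          simp only [mul_left_comm]
  · exact ContinuousOn.mul (by fun_prop)
      ((hu_cont.mono (Set.prod_mono_left hIcc)).sub (hw_cont.mono (Set.prod_mono_left hIcc)))
  · exact fun s hs y => DifferentiableAt.mul (by fun_prop)
      (((hu_time s (hIoo hs) y).differentiableAt (by norm_num)).sub
        ((hw_time s (hIoo hs) y).differentiableAt (by norm_num)))
  · exact fun s hs y => contDiffAt_const.mul
      ((hu_space s (hIoo hs) y).sub (hw_space s (hIoo hs) y))
  · intro s hs y
    have hs' := Set.Ioo_subset_Icc_self hs
    rw [hforce s hs y]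
    refine (abs_sub _ _).trans (add_le_add ?_ ((hRe s y).trans_le (hρMR s hs y)))
    rw [abs_mul, abs_neg, abs_of_nonneg (hquad s y)]
    exact mul_le_mul (hQ s hs' y) (hmM s hs' y) (abs_nonneg _)
      ((hquad s y).trans (hQ s hs' y))
  · exact Measurable.mul (by fun_prop) hR_meas.abs
  · intro s hs y
    have hs' := Set.Ioo_subset_Icc_self hs
    have hQ0 := (hquad s y).trans (hQ s hs' y)
    have hM0 := (abs_nonneg _).trans (hmM s hs' y)
    rw [abs_of_nonneg (by positivity)]
    exact (hρMR s hs y).trans (le_add_of_nonneg_left (mul_nonneg hQ0 hM0))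
  · intro s hs y h
    rw [hforce s hs y, ← hRe]
    linarith [mul_nonneg (hquad s y) h, neg_abs_le (rexp (-s) * R s y)]
  · intro s hs y h
    rw [hforce s hs y, ← hRe]
    linarith [mul_nonpos_of_nonneg_of_nonpos (hquad s y) h, le_abs_self (rexp (-s) * R s y)]
end

section
/- Let d ≥ 1 and let φ : ℝ^d → ℝ be smooth and compactly supported, and for ε > 0 set φ^ε(y) = ε^{-d} φ(y/ε). Then there exists a constant c > 0 (depending only on d and φ) such that for all t > 0 and all ε ∈ (0,1], the gradient of the convolution p_t * φ^ε satisfies ‖∇(p_t * φ^ε)‖_{L^2(ℝ^d)} ≤ c (max(t, ε^2))^{-d/4 - 1/2}. -/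
open Real MeasureTheory

open Module
open scoped ENNReal

section Convolution

variable {E : Type*} [NormedAddCommGroup E] [NormedSpace ℝ E] [FiniteDimensional ℝ E]
  [MeasurableSpace E] [BorelSpace E] (μ : Measure E)

/-- Young's inequality `‖f * g‖_{L²} ≤ ‖f‖_{L²} ‖g‖_{L¹}`, squared. -/
theorem lintegral_sq_lintegral_sub_mul_le [μ.IsAddHaarMeasure] {f g : E → ℝ≥0∞}
    (hf : Measurable f) (hg : Measurable g) :
    ∫⁻ z, (∫⁻ y, f (z - y) * g y ∂μ) ^ 2 ∂μ ≤ (∫⁻ y, g y ∂μ) ^ 2 * ∫⁻ z, f z ^ 2 ∂μ := by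
  have cauchy_schwarz (z : E) : (∫⁻ y, f (z - y) * g y ∂μ) ^ 2 ≤
      (∫⁻ y, g y ∂μ) * ∫⁻ y, f (z - y) ^ 2 * g y ∂μ := by
    have hfz : Measurable fun y => f (z - y) := hf.comp (measurable_const.sub measurable_id)
    have h := ENNReal.lintegral_mul_le_Lp_mul_Lq (μ.withDensity g)
      Real.HolderConjugate.two_two hfz.aemeasurable (aemeasurable_const (b := 1))
    simp only [Pi.mul_apply, mul_one, ENNReal.rpow_two] at h
    rw [lintegral_withDensity_eq_lintegral_mul _ hg hfz,
      lintegral_withDensity_eq_lintegral_mul _ hg (hfz.pow_const 2),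
      lintegral_withDensity_eq_lintegral_mul _ hg measurable_const] at h
    simp only [Pi.mul_apply, one_pow, mul_one] at h
    calc (∫⁻ y, f (z - y) * g y ∂μ) ^ 2
        ≤ ((∫⁻ y, g y * f (z - y) ^ 2 ∂μ) ^ (1 / 2 : ℝ) * (∫⁻ y, g y ∂μ) ^ (1 / 2 : ℝ)) ^ 2 := by
          simp only [mul_comm (f _)]
          gcongr
      _ = (∫⁻ y, g y ∂μ) * ∫⁻ y, f (z - y) ^ 2 * g y ∂μ := by
          rw [mul_pow, ← ENNReal.rpow_mul_natCast, ← ENNReal.rpow_mul_natCast, mul_comm]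
          norm_num
          simp only [mul_comm (g _)]
  have hsub : Measurable fun p : E × E => f (p.1 - p.2) ^ 2 * g p.2 :=
    ((hf.comp (measurable_fst.sub measurable_snd)).pow_const 2).mul (hg.comp measurable_snd)
  calc ∫⁻ z, (∫⁻ y, f (z - y) * g y ∂μ) ^ 2 ∂μ
      ≤ ∫⁻ z, (∫⁻ y, g y ∂μ) * ∫⁻ y, f (z - y) ^ 2 * g y ∂μ ∂μ := lintegral_mono cauchy_schwarz
    _ = (∫⁻ y, g y ∂μ) * ∫⁻ y, ∫⁻ z, f (z - y) ^ 2 * g y ∂μ ∂μ := by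
        rw [lintegral_const_mul _ hsub.lintegral_prod_right', lintegral_lintegral_swap]
        exact hsub.aemeasurable
    _ = (∫⁻ y, g y ∂μ) ^ 2 * ∫⁻ z, f z ^ 2 ∂μ := by
        have h (y : E) : ∫⁻ z, f (z - y) ^ 2 * g y ∂μ = (∫⁻ z, f z ^ 2 ∂μ) * g y := by
          have hfy : Measurable fun z => f (z - y) := hf.comp (measurable_id.sub_const y)
          rw [lintegral_mul_const _ (hfy.pow_const 2),
            lintegral_sub_right_eq_self (fun z => f z ^ 2) y]
        simp only [h]
        rw [lintegral_const_mul _ hg]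
        ring

/-- If `f` is `C¹` with `f` and `∇f` bounded and `g` is integrable, then `∇(f * g) = ∇f * g`, and
hence `‖∇(f * g)‖ ≤ ‖∇f‖ * |g|` pointwise. -/
theorem enorm_fderiv_integral_sub_mul_le {f g : E → ℝ} (hf : ContDiff ℝ 1 f) {A B : ℝ}
    (hA : ∀ x, ‖f x‖ ≤ A) (hB : ∀ x, ‖fderiv ℝ f x‖ ≤ B) (hg : Integrable g μ) (x : E) :
    ‖fderiv ℝ (fun z => ∫ y, f (z - y) * g y ∂μ) x‖ₑ ≤
      ∫⁻ y, ‖fderiv ℝ f (x - y)‖ₑ * ‖g y‖ₑ ∂μ := by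
  have hsub (z : E) : Continuous fun y => f (z - y) :=
    hf.continuous.comp (continuous_const.sub continuous_id)
  have hderiv : HasFDerivAt (fun z => ∫ y, f (z - y) * g y ∂μ)
      (∫ y, g y • fderiv ℝ f (x - y) ∂μ) x := by
    refine hasFDerivAt_integral_of_dominated_of_fderiv_le (s := Set.univ)
      (F' := fun z y => g y • fderiv ℝ f (z - y)) (bound := fun y => ‖g y‖ * B)
      Filter.univ_mem ?_ ?_ ?_ ?_ ?_ ?_
    · exact .of_forall fun z => (hsub z).aestronglyMeasurable.mul hg.aestronglyMeasurable
    · exact hg.bdd_mul (hsub x).aestronglyMeasurable (.of_forall fun y => hA _)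
    · exact hg.aestronglyMeasurable.smul ((hf.continuous_fderiv one_ne_zero).comp
        (continuous_const.sub continuous_id)).aestronglyMeasurable
    · refine .of_forall fun y z _ => ?_
      rw [norm_smul]
      gcongr
      exact hB _
    · exact hg.norm.mul_const B
    · refine .of_forall fun y z _ => ?_
      have h := ((hf.differentiable one_ne_zero (z - y)).hasFDerivAt.comp z
        ((hasFDerivAt_id z).sub_const y)).mul_const (g y)
      simpa using h
  rw [hderiv.fderiv]
  refine (enorm_integral_le_lintegral_enorm _).trans_eq ?_
  simp only [enorm_smul, mul_comm]

theorem lintegral_enorm_fderiv_integral_sub_mul_sq_le [μ.IsAddHaarMeasure]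
    {f g : E → ℝ} (hf : ContDiff ℝ 1 f) {A B : ℝ}
    (hA : ∀ x, ‖f x‖ ≤ A) (hB : ∀ x, ‖fderiv ℝ f x‖ ≤ B) (hg : Continuous g)
    (hgi : Integrable g μ) :
    ∫⁻ x, ‖fderiv ℝ (fun z => ∫ y, f (z - y) * g y ∂μ) x‖ₑ ^ 2 ∂μ ≤
      (∫⁻ y, ‖g y‖ₑ ∂μ) ^ 2 * ∫⁻ x, ‖fderiv ℝ f x‖ₑ ^ 2 ∂μ := by
  refine le_trans (lintegral_mono fun x => ?_) (lintegral_sq_lintegral_sub_mul_le μ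
    (hf.continuous_fderiv one_ne_zero).measurable.enorm hg.measurable.enorm)
  gcongr
  exact enorm_fderiv_integral_sub_mul_le μ hf hA hB hgi x

theorem lintegral_comp_inv_smul [μ.IsAddHaarMeasure] (f : E → ℝ≥0∞) {r : ℝ} (hr : 0 < r) :
    ∫⁻ x, f (r⁻¹ • x) ∂μ = ENNReal.ofReal (r ^ finrank ℝ E) * ∫⁻ x, f x ∂μ := by
  have h := lintegral_map_equiv (μ := μ) f
    (Homeomorph.smul (α := E) (Units.mk0 r⁻¹ (inv_ne_zero hr.ne'))).toMeasurableEquiv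
  change ∫⁻ x, f x ∂(μ.map (r⁻¹ • ·)) = ∫⁻ x, f (r⁻¹ • x) ∂μ at h
  rw [← h, Measure.map_addHaar_smul μ (inv_ne_zero hr.ne'), lintegral_smul_measure, inv_pow,
    inv_inv, abs_of_pos (pow_pos hr _), smul_eq_mul]

end Convolution

section HeatKernel

variable {d : ℕ} {t : ℝ}

theorem heatKernel_pos (ht : 0 < t) (x : EuclideanSpace ℝ (Fin d)) : 0 < heatKernel d t x := by
  unfold heatKernel
  positivity

theorem heatKernel_le (ht : 0 < t) (x : EuclideanSpace ℝ (Fin d)) :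
    heatKernel d t x ≤ (4 * π * t) ^ (-(d : ℝ) / 2) := by
  unfold heatKernel
  refine mul_le_of_le_one_right (by positivity) (Real.exp_le_one_iff.2 ?_)
  rw [neg_div, neg_nonpos]
  positivity

theorem contDiff_heatKernel : ContDiff ℝ 1 (heatKernel d t) :=
  contDiff_const.mul (((contDiff_norm_sq ℝ).neg.div_const _).exp)

theorem integral_heatKernel (ht : 0 < t) :
    ∫ x, heatKernel d t x = 1 := by
  have h := GaussianFourier.integral_rexp_neg_mul_sq_norm (V := EuclideanSpace ℝ (Fin d))
    (b := 1 / (4 * t)) (by positivity)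
  unfold heatKernel
  rw [integral_const_mul]
  have he (x : EuclideanSpace ℝ (Fin d)) :
      -‖x‖ ^ 2 / (4 * t) = -(1 / (4 * t)) * ‖x‖ ^ 2 := by ring
  simp only [he]
  rw [h, finrank_euclideanSpace_fin, show π / (1 / (4 * t)) = 4 * π * t by field_simp,
    ← Real.rpow_add (by positivity), neg_div, neg_add_cancel, Real.rpow_zero]

theorem integrable_heatKernel_s12 (ht : 0 < t) : Integrable (heatKernel d t) :=
  .of_integral_ne_zero (by rw [integral_heatKernel ht]; exact one_ne_zero)

theorem lintegral_enorm_heatKernel (ht : 0 < t) : ∫⁻ x, ‖heatKernel d t x‖ₑ = 1 := by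
  simp only [Real.enorm_of_nonneg (heatKernel_pos ht _).le]
  rw [← ofReal_integral_eq_lintegral_ofReal (integrable_heatKernel_s12 ht)
    (.of_forall fun x => (heatKernel_pos ht x).le), integral_heatKernel ht, ENNReal.ofReal_one]

theorem norm_fderiv_heatKernel_sq_le (ht : 0 < t) (x : EuclideanSpace ℝ (Fin d)) :
    ‖fderiv ℝ (heatKernel d t) x‖ ^ 2 ≤
      t⁻¹ * (4 * π * t) ^ (-(d : ℝ) / 2) * heatKernel d t x := by
  have hderiv : HasFDerivAt (heatKernel d t)
      ((-(2 * t)⁻¹ * heatKernel d t x) • innerSL ℝ x) x := by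
    have h := (((hasStrictFDerivAt_norm_sq x).hasFDerivAt.neg.mul_const (4 * t)⁻¹).exp).const_mul
      ((4 * π * t) ^ (-(d : ℝ) / 2))
    simp only [← div_eq_mul_inv] at h
    refine h.congr_fderiv ?_
    ext v
    simp [heatKernel]
    field_simp
    ring
  have hexp : ‖x‖ ^ 2 / (4 * t) * rexp (-‖x‖ ^ 2 / (4 * t)) ≤ 1 := by
    rw [neg_div, Real.exp_neg, ← div_eq_mul_inv, div_le_one (Real.exp_pos _)]
    linarith [Real.add_one_le_exp (‖x‖ ^ 2 / (4 * t))]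
  rw [hderiv.fderiv, norm_smul, innerSL_apply_norm, mul_pow, Real.norm_eq_abs, sq_abs]
  calc (-(2 * t)⁻¹ * heatKernel d t x) ^ 2 * ‖x‖ ^ 2
      = t⁻¹ * (4 * π * t) ^ (-(d : ℝ) / 2) * heatKernel d t x *
          (‖x‖ ^ 2 / (4 * t) * rexp (-‖x‖ ^ 2 / (4 * t))) := by
        simp only [heatKernel]
        field_simp
        ring
    _ ≤ t⁻¹ * (4 * π * t) ^ (-(d : ℝ) / 2) * heatKernel d t x :=
        mul_le_of_le_one_right
          (mul_nonneg (by positivity) (heatKernel_pos ht x).le) hexp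

theorem norm_fderiv_heatKernel_le (ht : 0 < t) (x : EuclideanSpace ℝ (Fin d)) :
    ‖fderiv ℝ (heatKernel d t) x‖ ≤
      √(t⁻¹ * (4 * π * t) ^ (-(d : ℝ) / 2) * (4 * π * t) ^ (-(d : ℝ) / 2)) := by
  refine Real.le_sqrt_of_sq_le ((norm_fderiv_heatKernel_sq_le ht x).trans ?_)
  gcongr
  exact heatKernel_le ht x

theorem lintegral_enorm_fderiv_heatKernel_sq_le (ht : 0 < t) :
    ∫⁻ x, ‖fderiv ℝ (heatKernel d t) x‖ₑ ^ 2 ≤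
      ENNReal.ofReal (t⁻¹ * (4 * π * t) ^ (-(d : ℝ) / 2)) := by
  calc ∫⁻ x, ‖fderiv ℝ (heatKernel d t) x‖ₑ ^ 2
      ≤ ∫⁻ x, ENNReal.ofReal (t⁻¹ * (4 * π * t) ^ (-(d : ℝ) / 2)) * ‖heatKernel d t x‖ₑ := by
        refine lintegral_mono fun x => ?_
        rw [Real.enorm_of_nonneg (heatKernel_pos ht x).le, ← ENNReal.ofReal_mul (by positivity),
          ← ofReal_norm, ← ENNReal.ofReal_pow (norm_nonneg _)]
        exact ENNReal.ofReal_le_ofReal (norm_fderiv_heatKernel_sq_le ht x)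
    _ = _ := by
        rw [lintegral_const_mul _ contDiff_heatKernel.continuous.measurable.enorm,
          lintegral_enorm_heatKernel ht, mul_one]

end HeatKernel

section Rescaling

variable {d : ℕ} {ε : ℝ}

theorem lintegral_enorm_rescale (φ : EuclideanSpace ℝ (Fin d) → ℝ) (hε : 0 < ε) :
    ∫⁻ y, ‖(ε ^ d)⁻¹ * φ (ε⁻¹ • y)‖ₑ = ∫⁻ y, ‖φ y‖ₑ := by
  rw [lintegral_comp_inv_smul volume (fun y => ‖(ε ^ d)⁻¹ * φ y‖ₑ) hε]
  simp only [enorm_mul]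
  rw [lintegral_const_mul' _ _ enorm_ne_top, ← mul_assoc, finrank_euclideanSpace_fin,
    Real.enorm_of_nonneg (by positivity), ← ENNReal.ofReal_mul (by positivity),
    mul_inv_cancel₀ (by positivity), ENNReal.ofReal_one, one_mul]

theorem fderiv_rescale (φ : EuclideanSpace ℝ (Fin d) → ℝ) (hφ : Differentiable ℝ φ)
    (x : EuclideanSpace ℝ (Fin d)) :
    fderiv ℝ (fun y => (ε ^ d)⁻¹ * φ (ε⁻¹ • y)) x =
      (ε ^ (d + 1))⁻¹ • fderiv ℝ φ (ε⁻¹ • x) := by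
  have h := ((hφ (ε⁻¹ • x)).hasFDerivAt.comp x
    ((hasFDerivAt_id x).const_smul ε⁻¹)).const_mul (ε ^ d)⁻¹
  refine h.fderiv.trans ?_
  ext v
  simp [pow_succ]
  ring

theorem lintegral_enorm_fderiv_rescale_sq (φ : EuclideanSpace ℝ (Fin d) → ℝ)
    (hφ : Differentiable ℝ φ) (hε : 0 < ε) :
    ∫⁻ y, ‖fderiv ℝ (fun y => (ε ^ d)⁻¹ * φ (ε⁻¹ • y)) y‖ₑ ^ 2 =
      ENNReal.ofReal ((ε ^ (d + 2))⁻¹) * ∫⁻ y, ‖fderiv ℝ φ y‖ₑ ^ 2 := by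
  simp only [fderiv_rescale φ hφ]
  rw [lintegral_comp_inv_smul volume (fun y => ‖(ε ^ (d + 1))⁻¹ • fderiv ℝ φ y‖ₑ ^ 2) hε]
  simp only [enorm_smul, mul_pow]
  rw [lintegral_const_mul' _ _ (ENNReal.pow_ne_top enorm_ne_top), ← mul_assoc,
    finrank_euclideanSpace_fin, Real.enorm_of_nonneg (by positivity),
    ← ENNReal.ofReal_pow (by positivity), ← ENNReal.ofReal_mul (by positivity)]
  congr 2
  field_simp
  ring

end Rescaling

/-- For smooth compactly supported `φ` and `φ^ε(y) = ε^{-d} φ(y/ε)` there is `c > 0` such that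
`‖∇(p_t * φ^ε)‖_{L²} ≤ c (max(t,ε²))^{-d/4-1/2}` for all `t > 0` and `ε ∈ (0,1]`. -/
theorem stmt12 (d : ℕ) (hd : 1 ≤ d) (φ : EuclideanSpace ℝ (Fin d) → ℝ)
    (hφ_smooth : ContDiff ℝ (⊤ : ℕ∞) φ) (hφ_supp : HasCompactSupport φ) :
    ∃ c : ℝ, 0 < c ∧ ∀ t : ℝ, 0 < t → ∀ ε ∈ Set.Ioc (0 : ℝ) 1,
      eLpNorm
        (fun x => ‖fderiv ℝ (fun z => ∫ y, heatKernel d t (z - y) * ((ε ^ d)⁻¹ * φ (ε⁻¹ • y))) x‖)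
        2 volume ≤
      ENNReal.ofReal (c * (max t (ε ^ 2)) ^ (-(d : ℝ) / 4 - 1 / 2)) := by
  have hφ1 : ContDiff ℝ 1 φ := hφ_smooth.of_le (by exact_mod_cast le_top)
  have hL1 : ∫⁻ y, ‖φ y‖ₑ ≠ ∞ := (hφ1.continuous.integrable_of_hasCompactSupport hφ_supp).2.ne
  have hL2 : ∫⁻ y, ‖fderiv ℝ φ y‖ₑ ^ 2 ≠ ∞ := by
    have hc : HasCompactSupport fun y => ‖fderiv ℝ φ y‖ ^ 2 :=
      (hφ_supp.fderiv ℝ).mono fun y hy h => hy (by simp [h])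
    have h := (((hφ1.continuous_fderiv one_ne_zero).norm.pow 2).integrable_of_hasCompactSupport
      hc (μ := volume)).2.ne
    simpa only [Pi.pow_apply, enorm_pow, enorm_norm] using h
  set M := (∫⁻ y, ‖φ y‖ₑ).toReal
  set K := (∫⁻ y, ‖fderiv ℝ φ y‖ₑ ^ 2).toReal
  have hM0 : 0 ≤ M := ENNReal.toReal_nonneg
  have hK0 : 0 ≤ K := ENNReal.toReal_nonneg
  set C := M ^ 2 * (4 * π) ^ (-(d : ℝ) / 2) + K + 1
  have hC0 : 0 < C := by positivity
  refine ⟨√C, Real.sqrt_pos.2 hC0, fun t ht ε hε => ?_⟩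
  have hε0 : 0 < ε := hε.1
  set ψ : EuclideanSpace ℝ (Fin d) → ℝ := fun y => (ε ^ d)⁻¹ * φ (ε⁻¹ • y)
  have hψ1 : ContDiff ℝ 1 ψ := contDiff_const.mul (hφ1.comp (contDiff_id.const_smul _))
  have hψ_supp : HasCompactSupport ψ :=
    (hφ_supp.comp_smul (inv_ne_zero hε0.ne')).mul_left
  have hψi : Integrable ψ := hψ1.continuous.integrable_of_hasCompactSupport hψ_supp
  have hsq : ∫⁻ x, ‖fderiv ℝ (fun z => ∫ y, heatKernel d t (z - y) * ψ y) x‖ₑ ^ 2 ≤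
      ENNReal.ofReal ((√C * (max t (ε ^ 2)) ^ (-(d : ℝ) / 4 - 1 / 2)) ^ 2) := by
    have hpow : (√C * (max t (ε ^ 2)) ^ (-(d : ℝ) / 4 - 1 / 2)) ^ 2 =
        C * (max t (ε ^ 2)) ^ (-(d : ℝ) / 2 - 1) := by
      rw [mul_pow, Real.sq_sqrt hC0.le, ← Real.rpow_mul_natCast (by positivity)]
      congr 2
      push_cast
      ring
    rw [hpow]
    rcases le_total (ε ^ 2) t with h | h
    · rw [max_eq_left h]
      refine (lintegral_enorm_fderiv_integral_sub_mul_sq_le volume contDiff_heatKernel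
        (fun x => (Real.norm_of_nonneg (heatKernel_pos ht x).le).trans_le (heatKernel_le ht x))
        (norm_fderiv_heatKernel_le ht) hψ1.continuous hψi).trans ?_
      rw [lintegral_enorm_rescale φ hε0, ← ENNReal.ofReal_toReal hL1,
        ← ENNReal.ofReal_pow hM0]
      refine (mul_le_mul_right (lintegral_enorm_fderiv_heatKernel_sq_le ht) _).trans ?_
      rw [← ENNReal.ofReal_mul (by positivity)]
      refine ENNReal.ofReal_le_ofReal ?_
      have hsplit : t⁻¹ * (4 * π * t) ^ (-(d : ℝ) / 2) =
          (4 * π) ^ (-(d : ℝ) / 2) * t ^ (-(d : ℝ) / 2 - 1) := by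
        rw [Real.mul_rpow (by positivity) ht.le, Real.rpow_sub_one ht.ne']
        ring
      rw [hsplit, ← mul_assoc]
      gcongr
      linarith
    · rw [max_eq_right h]
      have hswap (z : EuclideanSpace ℝ (Fin d)) :
          ∫ y, heatKernel d t (z - y) * ψ y = ∫ y, ψ (z - y) * heatKernel d t y := by
        rw [← integral_sub_left_eq_self _ volume z]
        simp only [sub_sub_self, mul_comm]
      simp only [hswap]
      obtain ⟨A, hA⟩ := hψ1.continuous.bounded_above_of_compact_support hψ_supp
      obtain ⟨B, hB⟩ := (hψ1.continuous_fderiv one_ne_zero).bounded_above_of_compact_support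
        (hψ_supp.fderiv ℝ)
      refine (lintegral_enorm_fderiv_integral_sub_mul_sq_le volume hψ1 hA hB
        contDiff_heatKernel.continuous (integrable_heatKernel_s12 ht)).trans ?_
      rw [lintegral_enorm_heatKernel ht, one_pow, one_mul,
        lintegral_enorm_fderiv_rescale_sq φ (hφ1.differentiable one_ne_zero) hε0,
        ← ENNReal.ofReal_toReal hL2, ← ENNReal.ofReal_mul (by positivity)]
      refine ENNReal.ofReal_le_ofReal ?_
      have hsplit : (ε ^ (d + 2))⁻¹ = (ε ^ 2) ^ (-(d : ℝ) / 2 - 1) := by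
        rw [← Real.rpow_natCast_mul hε0.le, ← Real.rpow_natCast, ← Real.rpow_neg hε0.le]
        congr 1
        push_cast
        ring
      rw [hsplit, mul_comm]
      gcongr
      have : 0 ≤ M ^ 2 * (4 * π) ^ (-(d : ℝ) / 2) := by positivity
      linarith
  rw [eLpNorm_norm, eLpNorm_eq_lintegral_rpow_enorm_toReal two_ne_zero ENNReal.ofNat_ne_top]
  simp only [ENNReal.toReal_ofNat, ENNReal.rpow_two]
  refine (ENNReal.rpow_le_rpow hsq (by norm_num)).trans_eq ?_
  rw [ENNReal.ofReal_pow (by positivity), ← ENNReal.rpow_natCast, ← ENNReal.rpow_mul]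
  norm_num
end
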